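/- For 2 ≤ p, q < ∞ and arbitrary measure spaces, the projective tensor product L_p ⊗̂ L_q has cotype max(p,q); that is, there is a constant C such that for every finite sequence u₁,…,u_N in L_p ⊗̂ L_q, (Σ_k ‖u_k‖_∧^{max(p,q)})^{1/max(p,q)} ≤ C (E‖Σ_k ε_k u_k‖_∧²)^{1/2}. -/

import Mathlib

open MeasureTheory Filter
open scoped ENNReal

/-- The Rademacher average `E ‖∑ εₖ uₖ‖²` over all choices of signs. -/
noncomputable def radAvgSq {B : Type*} [NormedAddCommGroup B] [NormedSpace ℂ B] {N : ℕ}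
    (u : Fin N → B) : ℝ :=
  (∑ s : Fin N → Bool, ‖∑ k, (if s k then (1 : ℂ) else -1) • u k‖ ^ 2) / 2 ^ N

/-- `B` has cotype `q` with constant `C`. -/
def HasCotype (B : Type*) [NormedAddCommGroup B] [NormedSpace ℂ B] (q C : ℝ) : Prop :=
  ∀ (N : ℕ) (u : Fin N → B),
    (∑ k, ‖u k‖ ^ q) ^ (1 / q) ≤ C * Real.sqrt (radAvgSq u)

/-- `j` realizes `B` as the projective tensor product `E ⊗̂ F`. -/
structure IsProjTensor {E F B : Type*} [NormedAddCommGroup E] [NormedSpace ℂ E]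
    [NormedAddCommGroup F] [NormedSpace ℂ F] [NormedAddCommGroup B] [NormedSpace ℂ B]
    (j : E →L[ℂ] F →L[ℂ] B) : Prop where
  norm_le : ∀ (x : E) (y : F), ‖j x y‖ ≤ ‖x‖ * ‖y‖
  dense_span : Dense ((Submodule.span ℂ (Set.range fun p : E × F => j p.1 p.2) : Submodule ℂ B) : Set B)
  lift : ∀ φ : E →L[ℂ] F →L[ℂ] ℂ, ∃ Φ : B →L[ℂ] ℂ, ‖Φ‖ ≤ ‖φ‖ ∧ ∀ x y, Φ (j x y) = φ x y

/-! ### Averages over signs -/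

/-- The real sign encoded by a Boolean. -/
def boolSign (b : Bool) : ℝ := if b then 1 else -1

section SignMean

variable {E F G : Type*} [AddCommGroup E] [Module ℝ E] [AddCommGroup F] [Module ℝ F]
  [AddCommGroup G] [Module ℝ G]

/-- The average of `f` over all choices of `N` signs. -/
noncomputable def signMean {N : ℕ} (f : (Fin N → Bool) → E) : E :=
  ((2 : ℝ) ^ N)⁻¹ • ∑ s, f s

/-- The Rademacher sum `∑ εₖ xₖ`. -/
noncomputable def signSum {N : ℕ} (x : Fin N → E) (s : Fin N → Bool) : E :=
  ∑ k, boolSign (s k) • x k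

lemma signMean_zero_vars (f : (Fin 0 → Bool) → E) : signMean f = f default := by
  rw [signMean, Fintype.sum_unique, pow_zero, inv_one, one_smul]
  exact congrArg f (Subsingleton.elim _ _)

lemma signMean_succ {N : ℕ} (f : (Fin (N + 1) → Bool) → E) :
    signMean f = signMean fun s : Fin N → Bool =>
      (2 : ℝ)⁻¹ • (f (Fin.cons true s) + f (Fin.cons false s)) := by
  have h : ∑ s, f s = ∑ s : Fin N → Bool, (f (Fin.cons true s) + f (Fin.cons false s)) := by
    rw [← (Fin.consEquiv fun _ : Fin (N + 1) => Bool).sum_comp, Fintype.sum_prod_type]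
    simp [Fin.consEquiv, Finset.sum_add_distrib]
  rw [signMean, signMean, h, ← Finset.smul_sum, smul_smul, pow_succ, mul_inv]

lemma signMean_add {N : ℕ} (f g : (Fin N → Bool) → E) :
    signMean (fun s => f s + g s) = signMean f + signMean g := by
  simp [signMean, Finset.sum_add_distrib]

lemma signMean_sub {N : ℕ} (f g : (Fin N → Bool) → E) :
    signMean (fun s => f s - g s) = signMean f - signMean g := by
  simp [signMean, Finset.sum_sub_distrib, smul_sub]

lemma signMean_smul {N : ℕ} (c : ℝ) (f : (Fin N → Bool) → E) :
    signMean (fun s => c • f s) = c • signMean f := by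
  simp only [signMean, ← Finset.smul_sum]
  exact smul_comm _ _ _

lemma signMean_sum {N : ℕ} {ι : Type*} (t : Finset ι) (f : ι → (Fin N → Bool) → E) :
    signMean (fun s => ∑ i ∈ t, f i s) = ∑ i ∈ t, signMean (f i) := by
  simp only [signMean]
  rw [Finset.sum_comm, Finset.smul_sum]

lemma map_signMean {N : ℕ} (T : E →ₗ[ℝ] F) (f : (Fin N → Bool) → E) :
    T (signMean f) = signMean fun s => T (f s) := by
  simp [signMean]

lemma signMean_const {N : ℕ} (c : E) : signMean (fun _ : Fin N → Bool => c) = c := by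
  have : ((2 ^ N : ℕ) : ℝ) = (2 : ℝ) ^ N := by push_cast; rfl
  simp [signMean, ← Nat.cast_smul_eq_nsmul ℝ, smul_smul]

lemma signSum_cons {N : ℕ} (x : Fin (N + 1) → E) (b : Bool) (s : Fin N → Bool) :
    signSum x (Fin.cons b s) = boolSign b • x 0 + signSum (fun k => x k.succ) s := by
  simp [signSum, Fin.sum_univ_succ]

lemma signMean_bilin {N : ℕ} (T : E →ₗ[ℝ] F →ₗ[ℝ] G) (x : Fin N → E) (y : Fin N → F) :
    signMean (fun s => T (signSum x s) (signSum y s)) = ∑ k, T (x k) (y k) := by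
  induction N with
  | zero => simp [signMean_zero_vars, signSum]
  | succ N ih =>
    rw [signMean_succ, Fin.sum_univ_succ, ← ih, ← signMean_const (N := N) (T (x 0) (y 0)),
      ← signMean_add]
    congr 1
    funext s
    simp only [signSum_cons, boolSign]
    simp only [map_add, map_smul, LinearMap.add_apply, LinearMap.smul_apply, if_true]
    simp only [Bool.false_eq_true, if_false]
    module

lemma signMean_mono {N : ℕ} [PartialOrder E] [IsOrderedAddMonoid E] [PosSMulMono ℝ E]
    {f g : (Fin N → Bool) → E} (h : ∀ s, f s ≤ g s) : signMean f ≤ signMean g :=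
  smul_le_smul_of_nonneg_left (Finset.sum_le_sum fun s _ => h s) (by positivity)

end SignMean

/-! ### The Khintchine-type inequality in a C⋆-algebra -/

section CStar

variable {A : Type*} [CStarAlgebra A]

/-- A smooth truncation of an element of a C⋆-algebra. -/
noncomputable def cstarTrunc (y : A) : A :=
  y * cfc (fun t : ℝ => (1 + t / 4)⁻¹) (star y * y)

lemma star_signSum {N : ℕ} (x : Fin N → A) (s : Fin N → Bool) :
    star (signSum x s) = signSum (fun k => star (x k)) s := by
  simp [signSum, star_sum]

lemma signMean_boolSign_smul_signSum {N : ℕ} (x : Fin N → A) (k : Fin N) :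
    signMean (fun s => boolSign (s k) • signSum x s) = x k := by
  have h := signMean_bilin (LinearMap.lsmul ℝ A) (Pi.single k (1 : ℝ)) x
  have h2 (s : Fin N → Bool) : signSum (Pi.single k (1 : ℝ)) s = boolSign (s k) := by
    simp [signSum, Pi.single_apply]
  simpa [h2, Pi.single_apply, Finset.sum_ite_eq] using h

lemma signMean_signSum_mul_mul {N : ℕ} (x y : Fin N → A) (c : A) :
    signMean (fun s => signSum x s * c * signSum y s) = ∑ k, x k * c * y k := by
  have h := signMean_bilin ((LinearMap.mul ℝ A).comp (LinearMap.mulRight ℝ c)) x y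
  simpa using h

variable [PartialOrder A] [StarOrderedRing A]

lemma nonneg_of_mem_spectrum_star_mul_self (y : A) {t : ℝ} (ht : t ∈ spectrum ℝ (star y * y)) :
    0 ≤ t :=
  spectrum_nonneg_of_nonneg (star_mul_self_nonneg y) ht

lemma continuousOn_truncFactor (y : A) :
    ContinuousOn (fun t : ℝ => (1 + t / 4)⁻¹) (spectrum ℝ (star y * y)) := by
  refine ContinuousOn.inv₀ (by fun_prop) fun t ht => ?_
  have := nonneg_of_mem_spectrum_star_mul_self y ht
  positivity

lemma truncFactor_mul (y : A) :
    cfc (fun t : ℝ => (1 + t / 4)⁻¹) (star y * y) * (1 + (4 : ℝ)⁻¹ • (star y * y)) = 1 := by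
  have hsa : IsSelfAdjoint (star y * y) := .star_mul_self y
  have h1 : (1 + (4 : ℝ)⁻¹ • (star y * y)) = cfc (fun t : ℝ => 1 + t / 4) (star y * y) := by
    rw [cfc_const_add (1 : ℝ) (fun t => t / 4) (star y * y), map_one]
    congr 1
    rw [show (fun t : ℝ => t / 4) = fun t => (4 : ℝ)⁻¹ • t by
      funext t; simp [div_eq_inv_mul], cfc_smul (4 : ℝ)⁻¹ (fun t : ℝ => t) _, cfc_id' ℝ (star y * y)]
  rw [h1, ← cfc_mul _ _ _ (continuousOn_truncFactor y) (by fun_prop), ← cfc_one ℝ (star y * y)]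
  refine cfc_congr fun t ht => ?_
  have := nonneg_of_mem_spectrum_star_mul_self y ht
  have : (1 + t / 4) ≠ 0 := by positivity
  simp [this]

lemma mul_truncFactor (y : A) :
    (1 + (4 : ℝ)⁻¹ • (star y * y)) * cfc (fun t : ℝ => (1 + t / 4)⁻¹) (star y * y) = 1 := by
  have h := congrArg star (truncFactor_mul y)
  have hsa : IsSelfAdjoint (cfc (fun t : ℝ => (1 + t / 4)⁻¹) (star y * y)) := cfc_predicate _ _
  simpa [hsa.star_eq] using h

lemma star_cstarTrunc (y : A) : star (cstarTrunc y) = cstarTrunc (star y) := by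
  have hsa : IsSelfAdjoint (cfc (fun t : ℝ => (1 + t / 4)⁻¹) (star y * y)) := cfc_predicate _ _
  have h1 := truncFactor_mul y
  have h2 := mul_truncFactor (star y)
  rw [cstarTrunc, cstarTrunc, star_mul, hsa.star_eq]
  set R := cfc (fun t : ℝ => (1 + t / 4)⁻¹) (star y * y)
  set R' := cfc (fun t : ℝ => (1 + t / 4)⁻¹) (star (star y) * star y)
  calc R * star y = R * (star y * ((1 + (4 : ℝ)⁻¹ • (star (star y) * star y)) * R')) := by
        rw [h2, mul_one]
    _ = R * (1 + (4 : ℝ)⁻¹ • (star y * y)) * (star y * R') := by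
        simp only [star_star, mul_add, add_mul, mul_one, one_mul, smul_mul_assoc,
          mul_smul_comm, mul_assoc]
    _ = star y * R' := by rw [h1, one_mul]

lemma norm_cstarTrunc_le (y : A) : ‖cstarTrunc y‖ ≤ 1 := by
  have hsa : IsSelfAdjoint (cfc (fun t : ℝ => (1 + t / 4)⁻¹) (star y * y)) := cfc_predicate _ _
  have hsy : IsSelfAdjoint (star y * y) := .star_mul_self y
  have hc := continuousOn_truncFactor y
  have h : star (cstarTrunc y) * cstarTrunc y ≤ 1 := by
    have : star (cstarTrunc y) * cstarTrunc y =
        cfc (fun t : ℝ => (1 + t / 4)⁻¹ * t * (1 + t / 4)⁻¹) (star y * y) := by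
      have hct : ContinuousOn (fun t : ℝ => (1 + t / 4)⁻¹ * t) (spectrum ℝ (star y * y)) :=
        hc.mul continuousOn_id
      rw [cfc_mul _ _ _ hct hc, cfc_mul _ (fun t : ℝ => t) _ hc continuousOn_id,
        cfc_id' ℝ (star y * y), cstarTrunc, star_mul, hsa.star_eq]
      simp only [mul_assoc]
    rw [this]
    refine cfc_le_one _ _ fun t ht => ?_
    have := nonneg_of_mem_spectrum_star_mul_self y ht
    field_simp
    nlinarith [sq_nonneg (t - 4)]
  have h2 := (CStarAlgebra.norm_le_one_iff_of_nonneg _ (star_mul_self_nonneg _)).2 h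
  rw [CStarRing.norm_star_mul_self] at h2
  nlinarith [norm_nonneg (cstarTrunc y)]

lemma star_sub_cstarTrunc_mul_le (y : A) :
    star (y - cstarTrunc y) * (y - cstarTrunc y) ≤
      (16 : ℝ)⁻¹ • ((star y * y) * (star y * y)) := by
  have hsa : IsSelfAdjoint (cfc (fun t : ℝ => (1 + t / 4)⁻¹) (star y * y)) := cfc_predicate _ _
  have hsy : IsSelfAdjoint (star y * y) := .star_mul_self y
  have hc := continuousOn_truncFactor y
  have hc' : ContinuousOn (fun t : ℝ => 1 - (1 + t / 4)⁻¹) (spectrum ℝ (star y * y)) :=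
    continuousOn_const.sub hc
  have h1 : star (y - cstarTrunc y) * (y - cstarTrunc y) =
      cfc (fun t : ℝ => (1 - (1 + t / 4)⁻¹) * t * (1 - (1 + t / 4)⁻¹)) (star y * y) := by
    have hct : ContinuousOn (fun t : ℝ => (1 - (1 + t / 4)⁻¹) * t) (spectrum ℝ (star y * y)) :=
      hc'.mul continuousOn_id
    rw [cfc_mul _ _ _ hct hc', cfc_mul _ (fun t : ℝ => t) _ hc' continuousOn_id,
      cfc_id' ℝ (star y * y), cfc_sub _ _ _ continuousOn_const hc,
      cfc_const_one ℝ (star y * y), cstarTrunc, star_sub, star_mul, hsa.star_eq]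
    noncomm_ring
  have h2 : (16 : ℝ)⁻¹ • ((star y * y) * (star y * y)) =
      cfc (fun t : ℝ => (16 : ℝ)⁻¹ • (t * t)) (star y * y) := by
    rw [cfc_smul (16 : ℝ)⁻¹ (fun t : ℝ => t * t) _, cfc_mul (fun t : ℝ => t) (fun t => t) _,
      cfc_id' ℝ (star y * y)]
  rw [h1, h2]
  refine cfc_mono (fun t ht => ?_) ((hc'.mul continuousOn_id).mul hc') (by fun_prop)
  have := nonneg_of_mem_spectrum_star_mul_self y ht
  have h3 : 1 - (1 + t / 4)⁻¹ = t / (t + 4) := by field_simp; ring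
  rw [h3, smul_eq_mul]
  have h4 : t / (t + 4) * t * (t / (t + 4)) = t * t * (t / (t + 4) ^ 2) := by field_simp
  rw [h4, mul_comm]
  refine mul_le_mul_of_nonneg_right ?_ (by positivity)
  rw [div_le_iff₀ (by positivity)]
  nlinarith [sq_nonneg (t - 4)]

lemma add_star_sq_le (c : A) :
    (c + star c) * (c + star c) ≤ (2 : ℝ) • (c * star c + star c * c) := by
  have h : 0 ≤ (c - star c) * star (c - star c) := mul_star_self_nonneg _
  have h2 : (2 : ℝ) • (c * star c + star c * c) =
      (c + star c) * (c + star c) + (c - star c) * star (c - star c) := by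
    rw [two_smul, star_sub, star_star]
    noncomm_ring
  rw [h2]
  exact le_add_of_nonneg_right h

lemma signMean_fourth_moment_le {N : ℕ} (x : Fin N → A) :
    signMean (fun s => (star (signSum x s) * signSum x s) * (star (signSum x s) * signSum x s)) ≤
      (∑ k, star (x k) * x k) * (∑ k, star (x k) * x k) +
        (2 : ℝ) • ∑ k, star (x k) * (∑ l, x l * star (x l)) * x k := by
  induction N with
  | zero => simp [signMean_zero_vars, signSum]
  | succ N ih =>
    set a := x 0 with ha
    set x' : Fin N → A := fun k => x k.succ with hx'
    have key (s : Fin N → Bool) :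
        (2 : ℝ)⁻¹ • ((star (signSum x (Fin.cons true s)) * signSum x (Fin.cons true s)) *
            (star (signSum x (Fin.cons true s)) * signSum x (Fin.cons true s)) +
          (star (signSum x (Fin.cons false s)) * signSum x (Fin.cons false s)) *
            (star (signSum x (Fin.cons false s)) * signSum x (Fin.cons false s))) ≤
        (star (signSum x' s) * signSum x' s) * (star (signSum x' s) * signSum x' s) +
          (star (signSum x' s) * 1 * signSum x' s) * (star a * a) +
          (star a * a) * (star (signSum x' s) * 1 * signSum x' s) +
          (star a * a) * (star a * a) +
          (2 : ℝ) • (star (signSum x' s) * (a * star a) * signSum x' s +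
            star a * (signSum x' s * 1 * star (signSum x' s)) * a) := by
      have h1 : signSum x (Fin.cons true s) = a + signSum x' s := by
        simp [signSum_cons, boolSign, ha, hx']
      have h2 : signSum x (Fin.cons false s) = signSum x' s - a := by
        simp only [signSum_cons, boolSign, ha, hx']
        simp [sub_eq_neg_add]
      rw [h1, h2]
      set y := signSum x' s
      have h3 := add_star_sq_le (star y * a)
      have h4 : (2 : ℝ)⁻¹ • ((star (a + y) * (a + y)) * (star (a + y) * (a + y)) +
          (star (y - a) * (y - a)) * (star (y - a) * (y - a))) =
          (star y * y + star a * a) * (star y * y + star a * a) +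
          (star y * a + star (star y * a)) * (star y * a + star (star y * a)) := by
        rw [inv_smul_eq_iff₀ two_ne_zero, two_smul]
        simp only [star_add, star_sub, star_mul, star_star]
        noncomm_ring
      rw [h4]
      refine (add_le_add_right h3 _).trans (le_of_eq ?_)
      simp only [star_mul, star_star, mul_one]
      simp only [mul_add, add_mul, mul_assoc]
      abel
    rw [signMean_succ]
    refine (signMean_mono key).trans ?_
    have e1 : signMean (fun s => star (signSum x' s) * 1 * signSum x' s) =
        ∑ k, star (x' k) * x' k := by
      simp only [star_signSum, signMean_signSum_mul_mul]
      simp only [mul_one]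
    have e2 : signMean (fun s => star (signSum x' s) * (a * star a) * signSum x' s) =
        ∑ k, star (x' k) * (a * star a) * x' k := by
      simp only [star_signSum, signMean_signSum_mul_mul]
    have e3 : signMean (fun s => signSum x' s * 1 * star (signSum x' s)) =
        ∑ k, x' k * star (x' k) := by
      simp only [star_signSum, signMean_signSum_mul_mul]
      simp only [mul_one]
    have m1 (b : A) (f : (Fin N → Bool) → A) :
        signMean (fun s => f s * b) = signMean f * b :=
      (map_signMean (LinearMap.mulRight ℝ b) f).symm
    have m2 (b : A) (f : (Fin N → Bool) → A) :
        signMean (fun s => b * f s) = b * signMean f :=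
      (map_signMean (LinearMap.mulLeft ℝ b) f).symm
    rw [signMean_add, signMean_add, signMean_add, signMean_add, signMean_smul, signMean_add,
      signMean_const, m1, m2, m1, m2, e1, e2, e3]
    simp only [Fin.sum_univ_succ]
    simp only [← ha]
    have hx (k : Fin N) : x k.succ = x' k := rfl
    simp only [hx]
    have ih' := ih x'
    set D := ∑ k, star (x' k) * x' k
    set R := ∑ k, x' k * star (x' k)
    have hQ : ∑ k, star (x' k) * (a * star a + R) * x' k =
        ∑ k, star (x' k) * (a * star a) * x' k + ∑ k, star (x' k) * R * x' k := by
      rw [← Finset.sum_add_distrib]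
      simp only [mul_add, add_mul]
    rw [hQ]
    have hpos : 0 ≤ (2 : ℝ) • ((star a * a) * (star a * a)) := by
      refine smul_nonneg zero_le_two ?_
      have := star_mul_self_nonneg (star a * a)
      simpa using this
    refine (add_le_add_left (add_le_add_left (add_le_add_left (add_le_add_left ih' _) _) _)
      _).trans ?_
    refine (le_add_of_nonneg_right hpos).trans (le_of_eq ?_)
    simp only [two_smul, mul_add, add_mul, mul_assoc]
    abel

lemma sum_star_mul_signMean_le {N : ℕ} (f : (Fin N → Bool) → A) :
    ∑ k, star (signMean fun s => boolSign (s k) • f s) * (signMean fun s => boolSign (s k) • f s)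
      ≤ signMean fun s => star (f s) * f s := by
  set z : Fin N → A := fun k => signMean fun s => boolSign (s k) • f s with hz
  have h0 : 0 ≤ signMean fun s => star (f s - signSum z s) * (f s - signSum z s) := by
    rw [← signMean_const (N := N) (0 : A)]
    exact signMean_mono fun s => star_mul_self_nonneg _
  have m1 (b : A) (g : (Fin N → Bool) → A) :
      signMean (fun s => g s * b) = signMean g * b :=
    (map_signMean (LinearMap.mulRight ℝ b) g).symm
  have m2 (b : A) (g : (Fin N → Bool) → A) :
      signMean (fun s => b * g s) = b * signMean g :=
    (map_signMean (LinearMap.mulLeft ℝ b) g).symm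
  have e1 : signMean (fun s => star (signSum z s) * f s) = ∑ k, star (z k) * z k := by
    simp only [star_signSum]
    simp only [signSum, Finset.sum_mul, signMean_sum]
    refine Finset.sum_congr rfl fun k _ => ?_
    rw [hz, ← m2]
    simp
  have e2 : signMean (fun s => star (f s) * signSum z s) = ∑ k, star (z k) * z k := by
    have := map_signMean (starLinearEquiv ℝ (A := A)).toLinearMap
      (fun s => star (signSum z s) * f s)
    rw [e1] at this
    simpa [star_sum] using this.symm
  have e3 : signMean (fun s => star (signSum z s) * signSum z s) = ∑ k, star (z k) * z k := by
    have := signMean_signSum_mul_mul (fun k => star (z k)) z 1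
    simpa [star_signSum] using this
  have e4 : (fun s => star (f s - signSum z s) * (f s - signSum z s)) = fun s =>
      (star (f s) * f s - star (f s) * signSum z s) -
        (star (signSum z s) * f s - star (signSum z s) * signSum z s) := by
    funext s
    rw [star_sub]
    noncomm_ring
  rw [e4, signMean_sub, signMean_sub, signMean_sub, e1, e2, e3, sub_self, sub_zero] at h0
  exact sub_nonneg.1 h0

lemma sum_star_mul_sub_trunc_le {N : ℕ} (x : Fin N → A)
    (hD : ∑ k, star (x k) * x k ≤ 1) (hR : ∑ k, x k * star (x k) ≤ 1) :
    ∑ k, star (x k - signMean fun s => boolSign (s k) • cstarTrunc (signSum x s)) *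
      (x k - signMean fun s => boolSign (s k) • cstarTrunc (signSum x s)) ≤ (4 : ℝ)⁻¹ • 1 := by
  have h (k : Fin N) : x k - signMean (fun s => boolSign (s k) • cstarTrunc (signSum x s)) =
      signMean fun s => boolSign (s k) • (signSum x s - cstarTrunc (signSum x s)) := by
    simp only [smul_sub, signMean_sub, signMean_boolSign_smul_signSum]
  simp only [h]
  refine (sum_star_mul_signMean_le _).trans ?_
  refine (signMean_mono fun s => star_sub_cstarTrunc_mul_le (signSum x s)).trans ?_
  rw [signMean_smul]
  have h1 := signMean_fourth_moment_le x
  set D := ∑ k, star (x k) * x k with hDdef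
  have hD0 : 0 ≤ D := Finset.sum_nonneg fun k _ => star_mul_self_nonneg _
  have h2 : D * D ≤ 1 := by
    have := CStarAlgebra.pow_antitone hD0 hD (Nat.zero_le 2)
    simpa [sq] using this
  have h3 : ∑ k, star (x k) * (∑ l, x l * star (x l)) * x k ≤ 1 := by
    refine le_trans (Finset.sum_le_sum fun k _ => ?_) hD
    have := star_left_conjugate_le_conjugate hR (x k)
    simpa using this
  have h4 := h1.trans (add_le_add h2 (smul_le_smul_of_nonneg_left h3 zero_le_two))
  refine (smul_le_smul_of_nonneg_left h4 (by positivity)).trans ?_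
  have h5 : (16 : ℝ)⁻¹ • ((1 : A) + (2 : ℝ) • 1) = (3 / 16 : ℝ) • 1 := by module
  rw [h5]
  exact smul_le_smul_of_nonneg_right (by norm_num) zero_le_one

lemma exists_signMean_approx (n : ℕ) {N : ℕ} (x : Fin N → A)
    (hD : ∑ k, star (x k) * x k ≤ 1) (hR : ∑ k, x k * star (x k) ≤ 1) :
    ∃ g : (Fin N → Bool) → A, (∀ s, ‖g s‖ ≤ 2) ∧
      ∀ k, ‖x k - signMean fun s => boolSign (s k) • g s‖ ≤ (2⁻¹ : ℝ) ^ n := by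
  induction n generalizing x with
  | zero =>
    refine ⟨0, by simp, fun k => ?_⟩
    have h0 : signMean (fun s : Fin N → Bool => boolSign (s k) • (0 : (Fin N → Bool) → A) s) = 0 := by
      simp [signMean]
    rw [h0, sub_zero, pow_zero]
    have h1 : star (x k) * x k ≤ 1 :=
      (Finset.single_le_sum (f := fun k => star (x k) * x k)
        (fun k _ => star_mul_self_nonneg _) (Finset.mem_univ k)).trans hD
    have h2 := (CStarAlgebra.norm_le_one_iff_of_nonneg _ (star_mul_self_nonneg _)).2 h1
    rw [CStarRing.norm_star_mul_self] at h2
    nlinarith [norm_nonneg (x k)]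
  | succ n ih =>
    set z : Fin N → A :=
      fun k => x k - signMean fun s => boolSign (s k) • cstarTrunc (signSum x s) with hz
    have hzD : ∑ k, star (z k) * z k ≤ (4 : ℝ)⁻¹ • 1 := sum_star_mul_sub_trunc_le x hD hR
    have hzR : ∑ k, z k * star (z k) ≤ (4 : ℝ)⁻¹ • 1 := by
      have := sum_star_mul_sub_trunc_le (fun k => star (x k)) (by simpa using hR)
        (by simpa using hD)
      have hs (k : Fin N) : star (z k) = star (x k) -
          signMean fun s => boolSign (s k) • cstarTrunc (signSum (fun k => star (x k)) s) := by
        have h1 := map_signMean (starLinearEquiv ℝ (A := A)).toLinearMap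
          (fun s => boolSign (s k) • cstarTrunc (signSum x s))
        simp only [LinearEquiv.coe_coe, starLinearEquiv_apply, star_smul, star_trivial,
          star_cstarTrunc, star_signSum] at h1
        rw [hz, star_sub, h1]
      simp only [← hs, star_star] at this
      exact this
    have hsmul {v : A} (hv : v ≤ (4 : ℝ)⁻¹ • 1) : (4 : ℝ) • v ≤ 1 := by
      have := smul_le_smul_of_nonneg_left hv (show (0 : ℝ) ≤ 4 by norm_num)
      rwa [smul_smul, mul_inv_cancel₀ (by norm_num), one_smul] at this
    obtain ⟨g, hg, hg'⟩ := ih (fun k => (2 : ℝ) • z k)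
      (by
        convert hsmul hzD using 1
        rw [Finset.smul_sum]
        refine Finset.sum_congr rfl fun k _ => ?_
        rw [star_smul, star_trivial, smul_mul_smul_comm]; norm_num)
      (by
        convert hsmul hzR using 1
        rw [Finset.smul_sum]
        refine Finset.sum_congr rfl fun k _ => ?_
        rw [star_smul, star_trivial, smul_mul_smul_comm]; norm_num)
    refine ⟨fun s => cstarTrunc (signSum x s) + (2⁻¹ : ℝ) • g s, fun s => ?_, fun k => ?_⟩
    · refine (norm_add_le _ _).trans ?_
      rw [norm_smul, Real.norm_of_nonneg (by norm_num)]
      linarith [norm_cstarTrunc_le (signSum x s), hg s]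
    · have : x k - signMean (fun s => boolSign (s k) •
          (cstarTrunc (signSum x s) + (2⁻¹ : ℝ) • g s)) =
          (2⁻¹ : ℝ) • ((2 : ℝ) • z k - signMean fun s => boolSign (s k) • g s) := by
        simp only [smul_add, signMean_add]
        simp only [smul_comm _ (2⁻¹ : ℝ), signMean_smul, hz]
        module
      rw [this, norm_smul, Real.norm_of_nonneg (by norm_num), pow_succ']
      exact mul_le_mul_of_nonneg_left (hg' k) (by norm_num)

/-- The dual form of the Khintchine inequality for operators that are both row and column
bounded. -/
theorem norm_sum_le_signMean_of_row_col {N : ℕ} (x : Fin N → A)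
    (hD : ∑ k, star (x k) * x k ≤ 1) (hR : ∑ k, x k * star (x k) ≤ 1)
    (τ : Fin N → A →L[ℂ] ℂ) (V : (Fin N → Bool) → ℝ)
    (hV : ∀ s (g : A), ‖g‖ ≤ 2 → ‖∑ k, boolSign (s k) • τ k g‖ ≤ V s) :
    ‖∑ k, τ k (x k)‖ ≤ signMean V := by
  have bound (n : ℕ) : ‖∑ k, τ k (x k)‖ ≤ signMean V + (∑ k, ‖τ k‖) * (2⁻¹ : ℝ) ^ n := by
    obtain ⟨g, hg, hg'⟩ := exists_signMean_approx n x hD hR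
    have h1 : ∑ k, τ k (x k) = signMean (fun s => ∑ k, boolSign (s k) • τ k (g s)) +
        ∑ k, τ k (x k - signMean fun s => boolSign (s k) • g s) := by
      rw [signMean_sum, ← Finset.sum_add_distrib]
      refine Finset.sum_congr rfl fun k _ => ?_
      have := map_signMean ((τ k).restrictScalars ℝ).toLinearMap (fun s => boolSign (s k) • g s)
      simp only [ContinuousLinearMap.coe_coe, ContinuousLinearMap.coe_restrictScalars', map_smul] at this
      rw [map_sub, this]
      simp
    rw [h1]
    refine (norm_add_le _ _).trans (add_le_add ?_ ?_)
    · rw [signMean, signMean, norm_smul, Real.norm_of_nonneg (by positivity), smul_eq_mul]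
      exact mul_le_mul_of_nonneg_left ((norm_sum_le _ _).trans
        (Finset.sum_le_sum fun s _ => hV s _ (hg s))) (by positivity)
    · rw [Finset.sum_mul]
      refine (norm_sum_le _ _).trans (Finset.sum_le_sum fun k _ => ?_)
      exact (τ k).le_opNorm_of_le (hg' k)
  have lim : Filter.Tendsto (fun n : ℕ => signMean V + (∑ k, ‖τ k‖) * (2⁻¹ : ℝ) ^ n)
      Filter.atTop (nhds (signMean V + (∑ k, ‖τ k‖) * 0)) :=
    ((tendsto_pow_atTop_nhds_zero_of_lt_one (by norm_num) (by norm_num)).const_mul _).const_add _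
  rw [mul_zero, add_zero] at lim
  exact ge_of_tendsto' lim bound

end CStar

/-! ### Moments of Rademacher sums -/

lemma two_point_pow_le {a d h c : ℝ} (ha : 0 ≤ a) (hh : 0 ≤ h) (hd : d ^ 2 ≤ 4 * a * h)
    (m : ℕ) (hm : 4 * m ≤ c) :
    (a + d) ^ m + (a - d) ^ m ≤ 2 * (a + c * h) ^ m ∧
      d * ((a + d) ^ m - (a - d) ^ m) ≤ 8 * m * h * (a + c * h) ^ m := by
  induction m with
  | zero => simp; norm_num
  | succ m ih =>
    push_cast at hm
    obtain ⟨h1, h2⟩ := ih (by linarith)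
    have hc : 0 ≤ c := le_trans (by positivity) hm
    have hch : 0 ≤ c * h := mul_nonneg hc hh
    set b := a + c * h with hb
    have hb0 : 0 ≤ b ^ m := pow_nonneg (by positivity) m
    have hP : 0 ≤ d ^ 2 := sq_nonneg d
    constructor
    · have e : (a + d) ^ (m + 1) + (a - d) ^ (m + 1) =
          a * ((a + d) ^ m + (a - d) ^ m) + d * ((a + d) ^ m - (a - d) ^ m) := by ring
      have h3 : (a + 4 * m * h) * b ^ m ≤ b * b ^ m := by
        refine mul_le_mul_of_nonneg_right ?_ hb0
        have := mul_le_mul_of_nonneg_right hm hh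
        rw [hb]
        nlinarith
      rw [e]
      calc _ ≤ a * (2 * b ^ m) + 8 * m * h * b ^ m :=
            add_le_add (mul_le_mul_of_nonneg_left h1 ha) h2
        _ = 2 * ((a + 4 * m * h) * b ^ m) := by ring
        _ ≤ 2 * (b * b ^ m) := by linarith
        _ = 2 * b ^ (m + 1) := by ring
    · have e : d * ((a + d) ^ (m + 1) - (a - d) ^ (m + 1)) =
          a * (d * ((a + d) ^ m - (a - d) ^ m)) + d ^ 2 * ((a + d) ^ m + (a - d) ^ m) := by ring
      rw [e]
      calc _ ≤ a * (8 * m * h * b ^ m) + d ^ 2 * (2 * b ^ m) :=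
            add_le_add (mul_le_mul_of_nonneg_left h2 ha) (mul_le_mul_of_nonneg_left h1 hP)
        _ ≤ a * (8 * m * h * b ^ m) + 4 * a * h * (2 * b ^ m) := by gcongr
        _ = (8 * (m + 1) * h * b ^ m) * a := by ring
        _ ≤ (8 * (m + 1) * h * b ^ m) * b :=
            mul_le_mul_of_nonneg_left (by linarith) (by positivity)
        _ = _ := by push_cast; ring

lemma signMean_add_norm_sq_pow_le {H : Type*} [NormedAddCommGroup H] [InnerProductSpace ℝ H]
    (m : ℕ) {N : ℕ} (x : Fin N → H) (v : H) {t : ℝ} (ht : 0 ≤ t) :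
    signMean (fun s => (t + ‖v + signSum x s‖ ^ 2) ^ m) ≤
      (t + ‖v‖ ^ 2 + (4 * m + 1) * ∑ k, ‖x k‖ ^ 2) ^ m := by
  induction N generalizing t with
  | zero => simp [signMean_zero_vars, signSum]
  | succ N ih =>
    have ih' := ih (fun k => x k.succ) (t := t + (4 * m + 1) * ‖x 0‖ ^ 2) (by positivity)
    rw [signMean_succ]
    refine (signMean_mono fun s => ?_).trans (ih'.trans (le_of_eq ?_))
    · set w := v + signSum (fun k => x k.succ) s with hw
      have e1 : v + signSum x (Fin.cons true s) = w + x 0 := by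
        simp [signSum_cons, boolSign, hw]; abel
      have e2 : v + signSum x (Fin.cons false s) = w - x 0 := by
        simp [signSum_cons, boolSign, hw]; abel
      have key := (two_point_pow_le (a := t + ‖w‖ ^ 2 + ‖x 0‖ ^ 2) (d := 2 * inner ℝ w (x 0))
        (h := ‖x 0‖ ^ 2) (c := 4 * m) (by positivity) (by positivity) ?_ m le_rfl).1
      · rw [e1, e2, norm_add_sq_real, norm_sub_sq_real, smul_eq_mul, inv_mul_le_iff₀ two_pos]
        refine le_trans (le_of_eq ?_) (key.trans (le_of_eq ?_)) <;> ring
      · have h1 : (inner ℝ w (x 0)) ^ 2 ≤ (‖w‖ * ‖x 0‖) ^ 2 := by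
          rw [sq_le_sq, abs_of_nonneg (by positivity : 0 ≤ ‖w‖ * ‖x 0‖)]
          exact abs_real_inner_le_norm _ _
        nlinarith [mul_nonneg ht (sq_nonneg ‖x 0‖), mul_nonneg (sq_nonneg ‖x 0‖) (sq_nonneg ‖x 0‖)]
    · rw [Fin.sum_univ_succ]; ring

lemma signMean_nonneg {N : ℕ} {f : (Fin N → Bool) → ℝ} (hf : ∀ s, 0 ≤ f s) :
    0 ≤ signMean f :=
  smul_nonneg (by positivity) (Finset.sum_nonneg fun s _ => hf s)

lemma signMean_rpow_le {N : ℕ} {f : (Fin N → Bool) → ℝ} (hf : ∀ s, 0 ≤ f s) {θ : ℝ}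
    (h0 : 0 < θ) (h1 : θ ≤ 1) : signMean (fun s => f s ^ θ) ≤ signMean f ^ θ := by
  have hw : ∑ _s : Fin N → Bool, ((2 : ℝ) ^ N)⁻¹ = 1 := by
    simp
  have h := Real.rpow_arith_mean_le_arith_mean_rpow Finset.univ (fun _ => ((2 : ℝ) ^ N)⁻¹)
    (fun s => f s ^ θ) (fun _ _ => by positivity) hw (fun s _ => Real.rpow_nonneg (hf s) _)
    (one_le_inv_iff₀.2 ⟨h0, h1⟩)
  have e (s : Fin N → Bool) : (f s ^ θ) ^ θ⁻¹ = f s := Real.rpow_rpow_inv (hf s) h0.ne'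
  simp only [e, ← Finset.mul_sum] at h
  have h2 : 0 ≤ signMean (fun s => f s ^ θ) := signMean_nonneg fun s => Real.rpow_nonneg (hf s) _
  have h3 := Real.rpow_le_rpow (Real.rpow_nonneg h2 _) h h0.le
  rwa [Real.rpow_inv_rpow h2 h0.ne'] at h3

lemma signMean_norm_rpow_le {H : Type*} [NormedAddCommGroup H] [InnerProductSpace ℝ H]
    {p : ℝ} (hp : 0 < p) {N : ℕ} (x : Fin N → H) :
    signMean (fun s => ‖signSum x s‖ ^ p) ≤
      ((4 * ⌈p⌉₊ + 1) * ∑ k, ‖x k‖ ^ 2) ^ (p / 2) := by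
  set m := ⌈p⌉₊ with hm
  have hpm : p ≤ m := Nat.le_ceil p
  have hm0 : (0 : ℝ) < m := hp.trans_le hpm
  have h := signMean_add_norm_sq_pow_le m x 0 le_rfl
  simp only [zero_add, norm_zero, ne_eq, OfNat.ofNat_ne_zero, not_false_eq_true, zero_pow] at h
  have h1 := signMean_rpow_le (f := fun s => (‖signSum x s‖ ^ 2) ^ m) (θ := p / (2 * m))
    (fun s => by positivity) (by positivity) (by rw [div_le_one (by positivity)]; linarith)
  have e (u : ℝ) (hu : 0 ≤ u) : (u ^ m) ^ (p / (2 * m)) = u ^ (p / 2) := by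
    rw [← Real.rpow_natCast, ← Real.rpow_mul hu]
    congr 1; field_simp
  have e2 (u : ℝ) (hu : 0 ≤ u) : (u ^ 2) ^ (p / 2) = u ^ p := by
    rw [← Real.rpow_natCast, ← Real.rpow_mul hu]
    congr 1; push_cast; field_simp
  have e3 (s : Fin N → Bool) : ((‖signSum x s‖ ^ 2) ^ m) ^ (p / (2 * m)) = ‖signSum x s‖ ^ p := by
    rw [e _ (by positivity), e2 _ (norm_nonneg _)]
  simp only [e3] at h1
  refine h1.trans ?_
  rw [← e _ (by positivity)]
  exact Real.rpow_le_rpow (signMean_nonneg fun s => by positivity) h (by positivity)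

/-! ### Finite-dimensional `ℓ_p` norms -/

/-- The `ℓ_p` norm of a finite family of real numbers. -/
noncomputable def lpNormFin {ι : Type*} [Fintype ι] (p : ℝ) (b : ι → ℝ) : ℝ :=
  (∑ i, |b i| ^ p) ^ (1 / p)

section LpNormFin

variable {ι κ : Type*} [Fintype ι] [Fintype κ] {p : ℝ}

lemma lpNormFin_nonneg (b : ι → ℝ) : 0 ≤ lpNormFin p b :=
  Real.rpow_nonneg (Finset.sum_nonneg fun _ _ => Real.rpow_nonneg (abs_nonneg _) _) _

lemma lpNormFin_add_le (hp : 1 ≤ p) (a b : ι → ℝ) :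
    lpNormFin p (a + b) ≤ lpNormFin p a + lpNormFin p b :=
  Real.Lp_add_le Finset.univ a b hp

lemma lpNormFin_smul (hp : 0 < p) {c : ℝ} (hc : 0 ≤ c) (b : ι → ℝ) :
    lpNormFin p (c • b) = c * lpNormFin p b := by
  have h (i : ι) : |(c • b) i| ^ p = c ^ p * |b i| ^ p := by
    rw [Pi.smul_apply, smul_eq_mul, abs_mul, abs_of_nonneg hc, Real.mul_rpow hc (abs_nonneg _)]
  rw [lpNormFin, lpNormFin]
  simp only [h, ← Finset.mul_sum]
  rw [Real.mul_rpow (by positivity) (Finset.sum_nonneg fun _ _ => by positivity), one_div,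
    Real.rpow_rpow_inv hc hp.ne']

lemma continuous_lpNormFin (hp : 0 < p) : Continuous (lpNormFin p : (ι → ℝ) → ℝ) := by
  unfold lpNormFin
  refine Continuous.rpow_const ?_ fun _ => Or.inr (by positivity)
  exact continuous_finsetSum _ fun i _ =>
    (continuous_apply i).abs.rpow_const fun _ => Or.inr hp.le

lemma lpNormFin_rpow (hp : 0 < p) (b : ι → ℝ) : lpNormFin p b ^ p = ∑ i, |b i| ^ p := by
  rw [lpNormFin, one_div, Real.rpow_inv_rpow (Finset.sum_nonneg fun _ _ => by positivity) hp.ne']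

lemma abs_le_lpNormFin (hp : 0 < p) (b : ι → ℝ) (i : ι) : |b i| ≤ lpNormFin p b := by
  rw [← Real.rpow_le_rpow_iff (abs_nonneg _) (lpNormFin_nonneg b) hp, lpNormFin_rpow hp]
  exact Finset.single_le_sum (f := fun i => |b i| ^ p) (fun _ _ => by positivity)
    (Finset.mem_univ i)

lemma lpNormFin_le_iff (hp : 0 < p) (b : ι → ℝ) {R : ℝ} (hR : 0 ≤ R) :
    lpNormFin p b ≤ R ↔ ∑ i, |b i| ^ p ≤ R ^ p := by
  rw [← Real.rpow_le_rpow_iff (lpNormFin_nonneg b) hR hp, lpNormFin_rpow hp]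

lemma lpNormFin_half_sq (hp : 0 < p) (x : ι → ℂ) :
    lpNormFin (p / 2) (fun i => ‖x i‖ ^ 2) = lpNormFin p (fun i => ‖x i‖) ^ 2 := by
  have h (i : ι) : |‖x i‖ ^ 2| ^ (p / 2) = |‖x i‖| ^ p := by
    rw [abs_of_nonneg (by positivity), abs_norm, ← Real.rpow_natCast, ← Real.rpow_mul (by positivity)]
    congr 1; push_cast; field_simp
  rw [lpNormFin, lpNormFin]
  simp only [h]
  rw [← Real.rpow_natCast, ← Real.rpow_mul (Finset.sum_nonneg fun _ _ => by positivity)]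
  congr 1; push_cast; field_simp

lemma sum_rpow_le_rpow_sum {α : Type*} {p : ℝ} (hp : 1 ≤ p) (s : Finset α) {c : α → ℝ}
    (hc : ∀ k, 0 ≤ c k) :
    ∑ k ∈ s, c k ^ p ≤ (∑ k ∈ s, c k) ^ p := by
  classical
  induction s using Finset.induction_on with
  | empty => simp [Real.zero_rpow (by linarith : p ≠ 0)]
  | insert a s ha ih =>
    rw [Finset.sum_insert ha, Finset.sum_insert ha]
    exact (add_le_add_right ih _).trans
      (Real.add_rpow_le_rpow_add (hc a) (Finset.sum_nonneg fun k _ => hc k) hp)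

lemma lpNormFin_anti {p r : ℝ} (hp : 0 < p) (hpr : p ≤ r) (b : ι → ℝ) :
    lpNormFin r b ≤ lpNormFin p b := by
  have hr : 0 < r := hp.trans_le hpr
  rw [lpNormFin_le_iff hr b (lpNormFin_nonneg b)]
  have h := sum_rpow_le_rpow_sum (p := r / p) ((one_le_div hp).2 hpr) Finset.univ
    (c := fun i => |b i| ^ p) fun i => by positivity
  rw [← lpNormFin_rpow hp] at h
  simp only [← Real.rpow_mul (abs_nonneg _), ← Real.rpow_mul (lpNormFin_nonneg (p := p) b),
    mul_div_cancel₀ r hp.ne'] at h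
  exact h

lemma lpNormFin_prod_le (hp : 1 ≤ p) {c : κ × ι → ℝ} (hc : ∀ k, 0 ≤ c k) :
    lpNormFin p c ≤ lpNormFin p (fun i => ∑ k, c (k, i)) := by
  rw [lpNormFin_le_iff (by linarith) _ (lpNormFin_nonneg _), lpNormFin_rpow (by linarith),
    Fintype.sum_prod_type, Finset.sum_comm]
  refine Finset.sum_le_sum fun i _ => ?_
  rw [abs_of_nonneg (Finset.sum_nonneg fun k _ => hc _)]
  simp only [abs_of_nonneg (hc _)]
  exact sum_rpow_le_rpow_sum hp _ fun k => hc _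

lemma signMean_lpNormFin_sq_le (hp : 2 ≤ p) {N : ℕ} (x : Fin N → ι → ℂ) :
    signMean (fun s => lpNormFin p (fun i => ‖signSum x s i‖) ^ 2) ≤
      (4 * ⌈p⌉₊ + 1) * lpNormFin (p / 2) (fun i => ∑ k, ‖x k i‖ ^ 2) := by
  have hp0 : 0 < p := by linarith
  have e (s : Fin N → Bool) : lpNormFin p (fun i => ‖signSum x s i‖) ^ 2 =
      (∑ i, ‖signSum (fun k => x k i) s‖ ^ p) ^ (2 / p) := by
    rw [lpNormFin, ← Real.rpow_natCast,
      ← Real.rpow_mul (Finset.sum_nonneg fun _ _ => by positivity)]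
    simp only [abs_norm]
    congr 1
    · simp [signSum, Finset.sum_apply]
    · push_cast; ring
  simp only [e]
  refine (signMean_rpow_le (fun s => Finset.sum_nonneg fun _ _ => by positivity) (by positivity)
    ((div_le_one hp0).2 hp)).trans ?_
  have hK : (0 : ℝ) ≤ 4 * ⌈p⌉₊ + 1 := by positivity
  rw [← lpNormFin_smul (by positivity) hK, lpNormFin, one_div_div]
  refine Real.rpow_le_rpow (signMean_nonneg fun s => Finset.sum_nonneg fun _ _ => by positivity)
    ?_ (by positivity)
  rw [signMean_sum]
  refine Finset.sum_le_sum fun i _ => (signMean_norm_rpow_le hp0 _).trans (le_of_eq ?_)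
  rw [abs_of_nonneg]
  · simp
  · exact mul_nonneg hK (Finset.sum_nonneg fun _ _ => by positivity)

end LpNormFin

/-! ### Weights from the Hahn–Banach theorem -/

lemma exists_weights_of_sum_le {Z T : Type*} [Fintype T] (n : (T → ℝ) → ℝ)
    (hn : Continuous n) (hadd : ∀ a b, n (a + b) ≤ n a + n b)
    (hsmul : ∀ c : ℝ, 0 ≤ c → ∀ a, n (c • a) = c * n a) (α : Z → T → ℝ) (θ : Z → ℝ)
    (h : ∀ (F : Finset Z) (c : Z → ℝ), (∀ z, 0 ≤ c z) →
      ∑ z ∈ F, c z * θ z ≤ n (∑ z ∈ F, c z • α z)) :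
    ∃ w : T → ℝ, (∀ b, ∑ i, w i * b i ≤ n b) ∧ ∀ z, θ z ≤ ∑ i, w i * α z i := by
  classical
  set S : Submodule NNReal ((T → ℝ) × ℝ) :=
    Submodule.span NNReal (Set.range fun z => (α z, θ z)) with hS
  have hSle : ∀ v ∈ S, v.2 ≤ n v.1 := by
    intro v hv
    obtain ⟨c, rfl⟩ := Finsupp.mem_span_range_iff_exists_finsupp.1 hv
    have := h c.support (fun z => c z) (fun z => (c z).2)
    simpa [Finsupp.sum, Prod.fst_sum, Prod.snd_sum, NNReal.smul_def] using this
  have hconvS : Convex ℝ (S : Set ((T → ℝ) × ℝ)) := by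
    intro a ha b hb s t hs ht _
    exact S.add_mem (S.smul_mem ⟨s, hs⟩ ha) (S.smul_mem ⟨t, ht⟩ hb)
  have hopen : IsOpen {v : (T → ℝ) × ℝ | n v.1 < v.2} :=
    isOpen_lt (hn.comp continuous_fst) continuous_snd
  have hconv : Convex ℝ {v : (T → ℝ) × ℝ | n v.1 < v.2} := by
    intro a ha b hb s t hs ht hst
    simp only [Set.mem_ofPred_eq, Prod.fst_add, Prod.smul_fst, Prod.snd_add, Prod.smul_snd,
      smul_eq_mul] at *
    refine (hadd _ _).trans_lt ?_
    rw [hsmul s hs, hsmul t ht]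
    rcases hs.eq_or_lt with rfl | hs'
    · have : t = 1 := by linarith
      subst this; linarith
    · nlinarith [mul_lt_mul_of_pos_left ha hs', mul_le_mul_of_nonneg_left hb.le ht]
  have hdisj : Disjoint {v : (T → ℝ) × ℝ | n v.1 < v.2} (S : Set ((T → ℝ) × ℝ)) := by
    rw [Set.disjoint_left]
    intro v hv hvS
    exact absurd (hSle v hvS) (not_le.2 hv)
  obtain ⟨f, u, hf1, hf2⟩ := geometric_hahn_banach_open hconv hopen hconvS hdisj
  have hu : u ≤ 0 := by simpa using hf2 0 S.zero_mem
  have hn0 : n 0 = 0 := by simpa using hsmul 0 le_rfl 0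
  have hc : f (0, 1) < 0 := (hf1 (0, 1) (by simp [hn0])).trans_le hu
  set c := f (0, 1) with hcdef
  have hdecomp (b : T → ℝ) (t : ℝ) : f (b, t) = f (b, 0) + t * c := by
    have : (b, t) = (b, (0 : ℝ)) + t • ((0 : T → ℝ), (1 : ℝ)) := by simp
    rw [this, map_add, map_smul, smul_eq_mul]
  have hsum (b : T → ℝ) : ∑ i, f (Pi.single i 1, 0) / (-c) * b i = f (b, 0) / (-c) := by
    have : (b, (0 : ℝ)) = ∑ i, b i • ((Pi.single i 1 : T → ℝ), (0 : ℝ)) := by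
      ext j
      · simp [Prod.fst_sum, Finset.sum_apply, Pi.single_apply]
      · simp [Prod.snd_sum]
    rw [this, map_sum, Finset.sum_div]
    refine Finset.sum_congr rfl fun i _ => ?_
    rw [map_smul, smul_eq_mul]; ring
  refine ⟨fun i => f (Pi.single i 1, 0) / (-c), fun b => ?_, fun z => ?_⟩
  · rw [hsum]
    refine le_of_forall_gt fun t ht => ?_
    have := (hf1 (b, t) ht).trans_le hu
    rw [hdecomp] at this
    rw [div_lt_iff₀ (by linarith)]
    linarith
  · rw [hsum, le_div_iff₀ (by linarith)]
    have hz : (α z, θ z) ∈ S := Submodule.subset_span ⟨z, rfl⟩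
    have hpos : 0 ≤ f (α z, θ z) := by
      by_contra! hneg
      obtain ⟨r, hr⟩ : ∃ r : NNReal, (r : ℝ) = (u - 1) / f (α z, θ z) :=
        ⟨⟨_, div_nonneg_of_nonpos (by linarith) hneg.le⟩, rfl⟩
      have h1 : u ≤ f ((r : ℝ) • (α z, θ z)) := hf2 _ (S.smul_mem r hz)
      rw [map_smul, smul_eq_mul, hr, div_mul_cancel₀ _ hneg.ne] at h1
      linarith
    rw [hdecomp] at hpos
    linarith

/-! ### Weighted estimates for families of bilinear forms -/

section Weights

variable {ι κ : Type*} [Fintype ι] [Fintype κ] {p q r : ℝ}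

/-- The constant in `signMean_lpNormFin_sq_le`. -/
noncomputable def khinchinConst (p : ℝ) : ℝ := 4 * ⌈p⌉₊ + 1

lemma khinchinConst_pos (p : ℝ) : 0 < khinchinConst p := by
  unfold khinchinConst; positivity

/-- The real part of a bilinear form given by a complex matrix. -/
noncomputable def reBilin (A : ι → κ → ℂ) : (ι → ℂ) →ₗ[ℝ] (κ → ℂ) →ₗ[ℝ] ℝ :=
  LinearMap.mk₂ ℝ (fun x y => (∑ i, ∑ j, A i j * x i * y j).re)
    (fun x x' y => by
      simp only [← Complex.add_re, ← Finset.sum_add_distrib, Pi.add_apply, mul_add, add_mul])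
    (fun c x y => by
      rw [← Complex.smul_re, Finset.smul_sum]
      simp only [Finset.smul_sum, Pi.smul_apply, Complex.real_smul]
      congr 1
      exact Finset.sum_congr rfl fun i _ => Finset.sum_congr rfl fun j _ => by ring)
    (fun x y y' => by
      simp only [← Complex.add_re, ← Finset.sum_add_distrib, Pi.add_apply, mul_add])
    (fun c x y => by
      rw [← Complex.smul_re, Finset.smul_sum]
      simp only [Finset.smul_sum, Pi.smul_apply, Complex.real_smul]
      congr 1
      exact Finset.sum_congr rfl fun i _ => Finset.sum_congr rfl fun j _ => by ring)

lemma reBilin_apply (A : ι → κ → ℂ) (x : ι → ℂ) (y : κ → ℂ) :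
    reBilin A x y = (∑ i, ∑ j, A i j * x i * y j).re := rfl

/-- A bounded matrix on `ℓ_p × ℓ_q` satisfies a square function estimate. -/
lemma sum_reBilin_le (hp : 2 ≤ p) (hq : 2 ≤ q) {A : ι → κ → ℂ}
    (hA : ∀ x y, reBilin A x y ≤
      lpNormFin p (fun i => ‖x i‖) * lpNormFin q (fun j => ‖y j‖))
    {m : ℕ} (x : Fin m → ι → ℂ) (y : Fin m → κ → ℂ) :
    ∑ a, reBilin A (x a) (y a) ≤
      khinchinConst p / 2 * lpNormFin (p / 2) (fun i => ∑ a, ‖x a i‖ ^ 2) +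
      khinchinConst q / 2 * lpNormFin (q / 2) (fun j => ∑ a, ‖y a j‖ ^ 2) := by
  have h1 := signMean_lpNormFin_sq_le hp x
  have h2 := signMean_lpNormFin_sq_le hq y
  rw [← signMean_bilin]
  have h3 : signMean (fun s => reBilin A (signSum x s) (signSum y s)) ≤
      signMean (fun s => (1 / 2 : ℝ) • lpNormFin p (fun i => ‖signSum x s i‖) ^ 2 +
        (1 / 2 : ℝ) • lpNormFin q (fun j => ‖signSum y s j‖) ^ 2) := by
    refine signMean_mono fun s => (hA _ _).trans ?_
    simp only [smul_eq_mul]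
    nlinarith [sq_nonneg (lpNormFin p (fun i => ‖signSum x s i‖) -
      lpNormFin q (fun j => ‖signSum y s j‖))]
  refine h3.trans ?_
  rw [signMean_add, signMean_smul, signMean_smul, smul_eq_mul, smul_eq_mul]
  unfold khinchinConst
  linarith

lemma lpNormFin_mono (hp : 0 < p) {b b' : ι → ℝ} (h : ∀ i, |b i| ≤ |b' i|) :
    lpNormFin p b ≤ lpNormFin p b' := by
  rw [lpNormFin_le_iff hp _ (lpNormFin_nonneg _), lpNormFin_rpow hp]
  exact Finset.sum_le_sum fun i _ => Real.rpow_le_rpow (abs_nonneg _) (h i) hp.le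

lemma lpNormFin_zero (hp : 0 < p) : lpNormFin p (fun _ : ι => 0) = 0 := by
  simp [lpNormFin, Real.zero_rpow hp.ne', Real.zero_rpow (inv_pos.2 hp).ne']

/-- A family of matrices, combined by a norm one functional on `ℓ_r`, is dominated by weighted
`ℓ₂` norms. -/
lemma exists_weights_of_bilin_le (hp : 2 ≤ p) (hq : 2 ≤ q) (hqr : q ≤ r) {N : ℕ}
    (M : Fin N → ι → κ → ℂ)
    (hM : ∀ k (x : ι → ℂ) (y : κ → ℂ), ‖∑ i, ∑ j, M k i j * x i * y j‖ ≤
      lpNormFin p (fun i => ‖x i‖) * lpNormFin q (fun j => ‖y j‖))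
    {a : Fin N → ℝ} (ha0 : ∀ k, 0 ≤ a k)
    (ha : ∀ t : Fin N → ℝ, (∀ k, 0 ≤ t k) → ∑ k, a k * t k ≤ lpNormFin r t) :
    ∃ (w : ι → ℝ) (v : κ → ℝ), (∀ i, 0 ≤ w i) ∧ (∀ j, 0 ≤ v j) ∧
      (∀ x : ι → ℂ, ∑ i, w i * ‖x i‖ ^ 2 ≤
        khinchinConst p / 2 * lpNormFin p (fun i => ‖x i‖) ^ 2) ∧
      (∀ y : κ → ℂ, ∑ j, v j * ‖y j‖ ^ 2 ≤
        khinchinConst q / 2 * lpNormFin q (fun j => ‖y j‖) ^ 2) ∧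
      ∀ (x : ι → ℂ) (y : Fin N → κ → ℂ), (∑ k, a k * ∑ i, ∑ j, M k i j * x i * y k j).re ≤
        ∑ i, w i * ‖x i‖ ^ 2 + ∑ k, ∑ j, v j * ‖y k j‖ ^ 2 := by
  have hp0 : 0 < p := by linarith
  have hq0 : 0 < q := by linarith
  set A : ι → Fin N × κ → ℂ := fun i kj => a kj.1 * M kj.1 i kj.2 with hAdef
  have hAe (x : ι → ℂ) (y : Fin N × κ → ℂ) : reBilin A x y =
      (∑ k, a k * ∑ i, ∑ j, M k i j * x i * y (k, j)).re := by
    rw [reBilin_apply]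
    congr 1
    simp only [hAdef, Fintype.sum_prod_type]
    rw [Finset.sum_comm]
    refine Finset.sum_congr rfl fun k _ => ?_
    rw [Finset.mul_sum]
    refine Finset.sum_congr rfl fun i _ => ?_
    rw [Finset.mul_sum]
    exact Finset.sum_congr rfl fun j _ => by ring
  have hA (x : ι → ℂ) (y : Fin N × κ → ℂ) : reBilin A x y ≤
      lpNormFin p (fun i => ‖x i‖) * lpNormFin q (fun j => ‖y j‖) := by
    rw [hAe]
    set t : Fin N → ℝ := fun k => lpNormFin q (fun j => ‖y (k, j)‖) with ht
    have ht0 (k) : 0 ≤ t k := lpNormFin_nonneg _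
    have h1 : lpNormFin r t ≤ lpNormFin q (fun kj => ‖y kj‖) := by
      refine (lpNormFin_anti hq0 hqr t).trans ?_
      rw [lpNormFin_le_iff hq0 _ (lpNormFin_nonneg _), lpNormFin_rpow hq0,
        Fintype.sum_prod_type]
      refine Finset.sum_le_sum fun k _ => le_of_eq ?_
      rw [abs_of_nonneg (ht0 k)]
      exact lpNormFin_rpow hq0 _
    calc _ ≤ ‖∑ k, (a k : ℂ) * ∑ i, ∑ j, M k i j * x i * y (k, j)‖ := Complex.re_le_norm _
      _ ≤ ∑ k, a k * (lpNormFin p (fun i => ‖x i‖) * t k) := by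
        refine norm_sum_le_of_le _ fun k _ => ?_
        rw [norm_mul, Complex.norm_real, Real.norm_of_nonneg (ha0 k)]
        exact mul_le_mul_of_nonneg_left (hM k x _) (ha0 k)
      _ = lpNormFin p (fun i => ‖x i‖) * ∑ k, a k * t k := by
        rw [Finset.mul_sum]
        exact Finset.sum_congr rfl fun k _ => by ring
      _ ≤ _ := mul_le_mul_of_nonneg_left ((ha t ht0).trans h1) (lpNormFin_nonneg _)
  set n : (ι ⊕ κ → ℝ) → ℝ := fun b =>
    khinchinConst p / 2 * lpNormFin (p / 2) (b ∘ Sum.inl) +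
      khinchinConst q / 2 * lpNormFin (q / 2) (b ∘ Sum.inr) with hn
  have hKp := khinchinConst_pos p
  have hKq := khinchinConst_pos q
  obtain ⟨w, hw1, hw2⟩ := exists_weights_of_sum_le (Z := (ι → ℂ) × (Fin N × κ → ℂ)) n
    (by
      have h1 := continuous_lpNormFin (ι := ι) (half_pos hp0)
      have h2 := continuous_lpNormFin (ι := κ) (half_pos hq0)
      have e1 : Continuous fun b : ι ⊕ κ → ℝ => b ∘ Sum.inl :=
        continuous_pi fun i => continuous_apply _
      have e2 : Continuous fun b : ι ⊕ κ → ℝ => b ∘ Sum.inr :=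
        continuous_pi fun i => continuous_apply _
      exact ((h1.comp e1).const_mul _).add ((h2.comp e2).const_mul _))
    (fun b b' => by
      have h1 := lpNormFin_add_le (p := p / 2) (by linarith) (b ∘ Sum.inl) (b' ∘ Sum.inl)
      have h2 := lpNormFin_add_le (p := q / 2) (by linarith) (b ∘ Sum.inr) (b' ∘ Sum.inr)
      have h1' := mul_le_mul_of_nonneg_left h1 (half_pos hKp).le
      have h2' := mul_le_mul_of_nonneg_left h2 (half_pos hKq).le
      have e1 : (b + b') ∘ Sum.inl = b ∘ Sum.inl + b' ∘ Sum.inl := rfl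
      have e2 : (b + b') ∘ Sum.inr = b ∘ Sum.inr + b' ∘ Sum.inr := rfl
      simp only [hn, e1, e2]
      linarith)
    (fun c hc b => by
      have h1 := lpNormFin_smul (half_pos hp0) hc (b ∘ Sum.inl)
      have h2 := lpNormFin_smul (half_pos hq0) hc (b ∘ Sum.inr)
      have e1 : (c • b) ∘ Sum.inl = c • (b ∘ Sum.inl) := rfl
      have e2 : (c • b) ∘ Sum.inr = c • (b ∘ Sum.inr) := rfl
      simp only [hn, e1, e2, h1, h2]
      ring)
    (fun z => Sum.elim (fun i => ‖z.1 i‖ ^ 2) (fun j => ∑ k, ‖z.2 (k, j)‖ ^ 2))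
    (fun z => reBilin A z.1 z.2)
    (by
      intro F c hc
      have h := sum_reBilin_le hp hq hA
        (fun b => √(c (F.equivFin.symm b)) • (F.equivFin.symm b : (ι → ℂ) × (Fin N × κ → ℂ)).1)
        (fun b => √(c (F.equivFin.symm b)) • (F.equivFin.symm b : (ι → ℂ) × (Fin N × κ → ℂ)).2)
      have hre {E : Type _} [AddCommMonoid E] (g : (ι → ℂ) × (Fin N × κ → ℂ) → E) :
          ∑ b, g (F.equivFin.symm b) = ∑ z ∈ F, g z := by
        rw [← Finset.sum_coe_sort F g, ← F.equivFin.symm.sum_comp]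
      have e1 : ∑ b, reBilin A
          (√(c (F.equivFin.symm b)) • (F.equivFin.symm b : (ι → ℂ) × (Fin N × κ → ℂ)).1)
          (√(c (F.equivFin.symm b)) • (F.equivFin.symm b : (ι → ℂ) × (Fin N × κ → ℂ)).2) =
          ∑ z ∈ F, c z * reBilin A z.1 z.2 := by
        rw [← hre]
        refine Finset.sum_congr rfl fun b _ => ?_
        rw [map_smul, map_smul, LinearMap.smul_apply, smul_smul, Real.mul_self_sqrt (hc _),
          smul_eq_mul]
      have hsq (z : (ι → ℂ) × (Fin N × κ → ℂ)) (u : ℂ) : ‖√(c z) • u‖ ^ 2 = c z * ‖u‖ ^ 2 := by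
        rw [norm_smul, mul_pow, Real.norm_of_nonneg (Real.sqrt_nonneg _), Real.sq_sqrt (hc _)]
      rw [e1] at h
      refine h.trans ?_
      simp only [hn, Pi.smul_apply, hsq]
      have e2 (i : ι) : ∑ b, c (F.equivFin.symm b) *
          ‖(F.equivFin.symm b : (ι → ℂ) × (Fin N × κ → ℂ)).1 i‖ ^ 2 =
          ∑ z ∈ F, c z * ‖z.1 i‖ ^ 2 := hre fun z => c z * ‖z.1 i‖ ^ 2
      have e3 (j : Fin N × κ) : ∑ b, c (F.equivFin.symm b) *
          ‖(F.equivFin.symm b : (ι → ℂ) × (Fin N × κ → ℂ)).2 j‖ ^ 2 =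
          ∑ z ∈ F, c z * ‖z.2 j‖ ^ 2 := hre fun z => c z * ‖z.2 j‖ ^ 2
      simp only [e2, e3]
      refine add_le_add (le_of_eq ?_) (mul_le_mul_of_nonneg_left ?_ (half_pos hKq).le)
      · congr 2
        funext i
        simp [Finset.sum_apply]
      · refine (lpNormFin_prod_le (by linarith) fun j =>
          Finset.sum_nonneg fun z _ => mul_nonneg (hc z) (by positivity)).trans (le_of_eq ?_)
        congr 1
        funext j
        simp only [Function.comp_apply, Finset.sum_apply, Pi.smul_apply, Sum.elim_inr,
          smul_eq_mul, Finset.mul_sum]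
        exact Finset.sum_comm)
  have habs (t b : ℝ) : |(SignType.sign t : ℝ) * b| ≤ |b| := by
    rcases lt_trichotomy t 0 with h | h | h <;> simp [h]
  refine ⟨fun i => |w (Sum.inl i)|, fun j => |w (Sum.inr j)|, fun i => abs_nonneg _,
    fun j => abs_nonneg _, fun x => ?_, fun y => ?_, fun x y => ?_⟩
  · have h := hw1 (Sum.elim (fun i => SignType.sign (w (Sum.inl i)) * ‖x i‖ ^ 2) fun _ => 0)
    simp only [Fintype.sum_sum_type, Sum.elim_inl, Sum.elim_inr, mul_zero,
      Finset.sum_const_zero, add_zero, hn, ← mul_assoc, self_mul_sign, Sum.elim_comp_inl,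
      Sum.elim_comp_inr, lpNormFin_zero (half_pos hq0)] at h
    refine h.trans ?_
    rw [← lpNormFin_half_sq hp0]
    exact mul_le_mul_of_nonneg_left (lpNormFin_mono (half_pos hp0) fun i => habs _ _)
      (half_pos hKp).le
  · have h := hw1 (Sum.elim (fun _ => 0) fun j => SignType.sign (w (Sum.inr j)) * ‖y j‖ ^ 2)
    simp only [Fintype.sum_sum_type, Sum.elim_inl, Sum.elim_inr, mul_zero,
      Finset.sum_const_zero, zero_add, hn, ← mul_assoc, self_mul_sign, Sum.elim_comp_inl,
      Sum.elim_comp_inr, lpNormFin_zero (half_pos hp0)] at h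
    refine h.trans ?_
    rw [← lpNormFin_half_sq hq0]
    exact mul_le_mul_of_nonneg_left (lpNormFin_mono (half_pos hq0) fun i => habs _ _)
      (half_pos hKq).le
  · have h := hw2 (x, fun kj => y kj.1 kj.2)
    rw [hAe] at h
    refine h.trans ?_
    rw [Fintype.sum_sum_type]
    refine add_le_add (Finset.sum_le_sum fun i _ =>
      mul_le_mul_of_nonneg_right (le_abs_self _) (by simp)) ?_
    rw [Finset.sum_comm]
    refine Finset.sum_le_sum fun j _ => ?_
    rw [Sum.elim_inr, ← Finset.mul_sum]
    exact mul_le_mul_of_nonneg_right (le_abs_self _) (Finset.sum_nonneg fun _ _ => by positivity)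

end Weights

/-! ### Square functions of matrices -/

section Matrices

open Matrix
open scoped ComplexOrder MatrixOrder Matrix.Norms.L2Operator

variable {ι : Type*} [Fintype ι] [DecidableEq ι]

lemma norm_matrix_bilin_le (g : Matrix ι ι ℂ) (x y : ι → ℂ) :
    ‖∑ i, ∑ j, g i j * x i * y j‖ ≤ ‖g‖ * √(∑ i, ‖x i‖ ^ 2) * √(∑ j, ‖y j‖ ^ 2) := by
  have h1 := norm_inner_le_norm (𝕜 := ℂ) (WithLp.toLp 2 (star x) : EuclideanSpace ℂ ι)
    (WithLp.toLp 2 (g *ᵥ y))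
  have h2 : ‖(WithLp.toLp 2 (g *ᵥ y) : EuclideanSpace ℂ ι)‖ ≤
    ‖g‖ * ‖(WithLp.toLp 2 y : EuclideanSpace ℂ ι)‖ := g.l2_opNorm_mulVec (WithLp.toLp 2 y)
  have e : inner ℂ (WithLp.toLp 2 (star x) : EuclideanSpace ℂ ι) (WithLp.toLp 2 (g *ᵥ y)) =
      ∑ i, ∑ j, g i j * x i * y j := by
    rw [PiLp.inner_apply]
    refine Finset.sum_congr rfl fun i _ => ?_
    simp only [mulVec, dotProduct, RCLike.inner_apply, Pi.star_apply, RCLike.star_def,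
      Complex.conj_conj, Finset.sum_mul]
    exact Finset.sum_congr rfl fun j _ => by ring
  rw [e] at h1
  refine h1.trans ((mul_le_mul_of_nonneg_left h2 (norm_nonneg _)).trans (le_of_eq ?_))
  rw [EuclideanSpace.norm_eq, EuclideanSpace.norm_eq]
  simp only [Pi.star_apply, norm_star]
  ring

lemma sum_star_mul_self_le_one {N : ℕ} (x : Fin N → Matrix ι ι ℂ)
    (h : ∀ ξ : ι → ℂ, ∑ k, ∑ i, ‖(x k *ᵥ ξ) i‖ ^ 2 ≤ ∑ i, ‖ξ i‖ ^ 2) :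
    ∑ k, star (x k) * x k ≤ 1 := by
  rw [Matrix.le_iff]
  refine PosSemidef.of_dotProduct_mulVec_nonneg ?_ fun ξ => ?_
  · refine (isHermitian_one).sub ?_
    change (∑ k, star (x k) * x k)ᴴ = _
    rw [conjTranspose_sum]
    refine Finset.sum_congr rfl fun k _ => ?_
    rw [star_eq_conjTranspose, conjTranspose_mul, conjTranspose_conjTranspose]
  · have hs (v : ι → ℂ) : star v ⬝ᵥ v = ((∑ i, ‖v i‖ ^ 2 : ℝ) : ℂ) := by
      push_cast
      refine Finset.sum_congr rfl fun i _ => ?_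
      rw [Pi.star_apply, RCLike.star_def, Complex.conj_mul']
    have e : star ξ ⬝ᵥ ((1 - ∑ k, star (x k) * x k) *ᵥ ξ) =
        ((∑ i, ‖ξ i‖ ^ 2 - ∑ k, ∑ i, ‖(x k *ᵥ ξ) i‖ ^ 2 : ℝ) : ℂ) := by
      rw [sub_mulVec, one_mulVec, dotProduct_sub, hs, sum_mulVec, dotProduct_sum,
        Complex.ofReal_sub, Complex.ofReal_sum _ fun k => ∑ i, ‖(x k *ᵥ ξ) i‖ ^ 2]
      refine congrArg₂ _ rfl (Finset.sum_congr rfl fun k _ => ?_)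
      rw [← hs, ← mulVec_mulVec, dotProduct_mulVec, star_eq_conjTranspose, star_mulVec]
    rw [e]
    exact_mod_cast sub_nonneg.2 (h ξ)

lemma sum_mul_star_self_le_one {N : ℕ} (x : Fin N → Matrix ι ι ℂ)
    (h : ∀ ξ : ι → ℂ, ∑ k, ∑ i, ‖((x k)ᵀ *ᵥ ξ) i‖ ^ 2 ≤ ∑ i, ‖ξ i‖ ^ 2) :
    ∑ k, x k * star (x k) ≤ 1 := by
  have := sum_star_mul_self_le_one (ι := ι) (fun k => star (x k)) fun ξ => by
    have h1 := h (star ξ)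
    have e (k : Fin N) : star (x k) *ᵥ ξ = star ((x k)ᵀ *ᵥ star ξ) := by
      rw [star_mulVec, star_star, star_eq_conjTranspose, ← mulVec_transpose]
      rfl
    simpa only [e, Pi.star_apply, norm_star] using h1
  simpa only [star_star] using this

end Matrices

/-- A bilinear estimate with an `ℓ₂` sum over `k` is a square function estimate. -/
lemma sum_norm_sq_le_of_re_le {ι κ : Type*} [Fintype ι] [Fintype κ] {N : ℕ}
    (X : Fin N → κ → ι → ℂ)
    (h : ∀ (x : ι → ℂ) (y : Fin N → κ → ℂ), (∑ k, ∑ j, (∑ i, X k j i * x i) * y k j).re ≤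
      ∑ i, ‖x i‖ ^ 2 + ∑ k, ∑ j, ‖y k j‖ ^ 2) (x : ι → ℂ) :
    ∑ k, ∑ j, ‖∑ i, X k j i * x i‖ ^ 2 ≤ 4 * ∑ i, ‖x i‖ ^ 2 := by
  have h1 := h x fun k j => (1 / 2 : ℝ) * star (∑ i, X k j i * x i)
  have e (z : ℂ) : z * ((1 / 2 : ℝ) * star z) = ((1 / 2 * ‖z‖ ^ 2 : ℝ) : ℂ) := by
    rw [mul_left_comm, RCLike.star_def, Complex.mul_conj']
    push_cast
    rfl
  have e2 (z : ℂ) : ‖((1 / 2 : ℝ) : ℂ) * star z‖ ^ 2 = 1 / 4 * ‖z‖ ^ 2 := by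
    rw [norm_mul, norm_star, Complex.norm_real, mul_pow]
    norm_num
  simp only [e, e2, ← Complex.ofReal_sum, Complex.ofReal_re, ← Finset.mul_sum] at h1
  linarith

section Square

open scoped MatrixOrder Matrix.Norms.L2Operator

variable {ι : Type*} [Fintype ι] {p q r : ℝ}

lemma sum_inv_card_mul_sq_le (hp : 0 < p) (x : ι → ℂ) :
    ∑ i, (Fintype.card ι : ℝ)⁻¹ * ‖x i‖ ^ 2 ≤ lpNormFin p (fun i => ‖x i‖) ^ 2 := by
  have h (i : ι) : (Fintype.card ι : ℝ)⁻¹ * ‖x i‖ ^ 2 ≤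
      (Fintype.card ι : ℝ)⁻¹ * lpNormFin p (fun i => ‖x i‖) ^ 2 := by
    have := abs_le_lpNormFin hp (fun i => ‖x i‖) i
    rw [abs_norm] at this
    gcongr
  refine (Finset.sum_le_sum fun i _ => h i).trans ?_
  rw [Finset.sum_const, Finset.card_univ, nsmul_eq_mul, ← mul_assoc]
  rcases isEmpty_or_nonempty ι with hι | hι
  · simp; positivity
  · rw [mul_inv_cancel₀ (by positivity), one_mul]

/-- The constant in the duality estimate for finite matrices. -/
noncomputable def matrixCotypeConst (p q : ℝ) : ℝ :=
  2 * (√(khinchinConst p + 1) * √(khinchinConst q + 1))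

/-- Dual form of the cotype inequality for `ℓ_p ⊗ ℓ_q` in finite dimensions. -/
theorem norm_sum_smul_pairing_le (hp : 2 ≤ p) (hq : 2 ≤ q) (hpr : p ≤ r) (hqr : q ≤ r) {N : ℕ}
    (M : Fin N → ι → ι → ℂ)
    (hM : ∀ k (x y : ι → ℂ), ‖∑ i, ∑ j, M k i j * x i * y j‖ ≤
      lpNormFin p (fun i => ‖x i‖) * lpNormFin q (fun j => ‖y j‖))
    {a : Fin N → ℝ} (ha0 : ∀ k, 0 ≤ a k)
    (ha : ∀ t : Fin N → ℝ, (∀ k, 0 ≤ t k) → ∑ k, a k * t k ≤ lpNormFin r t)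
    (U : Fin N → ι → ι → ℂ) (V : (Fin N → Bool) → ℝ)
    (hV : ∀ (s : Fin N → Bool) (G : ι → ι → ℂ),
      (∀ x y : ι → ℂ, ‖∑ i, ∑ j, G i j * x i * y j‖ ≤ matrixCotypeConst p q *
        (lpNormFin p (fun i => ‖x i‖) * lpNormFin q (fun j => ‖y j‖))) →
      ‖∑ k, boolSign (s k) • ∑ i, ∑ j, G i j * U k i j‖ ≤ V s) :
    ‖∑ k, a k * ∑ i, ∑ j, M k i j * U k i j‖ ≤ 2 * signMean V := by
  classical
  have hp0 : 0 < p := by linarith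
  have hq0 : 0 < q := by linarith
  obtain ⟨w₁, v₁, hw₁, hv₁, hwp₁, hvq₁, hb₁⟩ := exists_weights_of_bilin_le hp hq hqr M hM ha0 ha
  obtain ⟨v₂, w₂, hv₂, hw₂, hvq₂, hwp₂, hb₂⟩ := exists_weights_of_bilin_le hq hp hpr
    (fun k j i => M k i j) (fun k y x => by
      rw [Finset.sum_comm, mul_comm (lpNormFin _ _)]
      simpa only [mul_right_comm] using hM k x y) ha0 ha
  set d : ℝ := (Fintype.card ι : ℝ)⁻¹ with hd
  set w : ι → ℝ := fun i => w₁ i + w₂ i + d with hw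
  set v : ι → ℝ := fun j => v₁ j + v₂ j + d with hv
  have hd0 (i : ι) : 0 < d := by
    have : Nonempty ι := ⟨i⟩
    positivity
  have hd0' : 0 ≤ d := by positivity
  have hw0 (i) : 0 < w i := by have := hd0 i; have := hw₁ i; have := hw₂ i; simp only [hw]; linarith
  have hv0 (i) : 0 < v i := by have := hd0 i; have := hv₁ i; have := hv₂ i; simp only [hv]; linarith
  have hwp (x : ι → ℂ) : ∑ i, w i * ‖x i‖ ^ 2 ≤
      (khinchinConst p + 1) * lpNormFin p (fun i => ‖x i‖) ^ 2 := by
    have h1 := hwp₁ x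
    have h2 := hwp₂ x
    have h3 := sum_inv_card_mul_sq_le hp0 x
    simp only [hw, add_mul, Finset.sum_add_distrib]
    linarith
  have hvq (x : ι → ℂ) : ∑ i, v i * ‖x i‖ ^ 2 ≤
      (khinchinConst q + 1) * lpNormFin q (fun i => ‖x i‖) ^ 2 := by
    have h1 := hvq₁ x
    have h2 := hvq₂ x
    have h3 := sum_inv_card_mul_sq_le hq0 x
    simp only [hv, add_mul, Finset.sum_add_distrib]
    linarith
  have hsw (i) : ((√(w i) : ℝ) : ℂ) ≠ 0 := by
    exact_mod_cast (Real.sqrt_pos.2 (hw0 i)).ne'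
  have hsv (i) : ((√(v i) : ℝ) : ℂ) ≠ 0 := by
    exact_mod_cast (Real.sqrt_pos.2 (hv0 i)).ne'
  have hscale {t : ℝ} (ht : 0 < t) (z : ℂ) : t * ‖z / (√t : ℝ)‖ ^ 2 = ‖z‖ ^ 2 := by
    rw [norm_div, Complex.norm_real, Real.norm_of_nonneg (Real.sqrt_nonneg _), div_pow,
      Real.sq_sqrt ht.le, mul_div_cancel₀ _ ht.ne']
  set X : Fin N → Matrix ι ι ℂ := fun k =>
    Matrix.of fun i j => a k * M k i j / ((√(w i) : ℝ) * (√(v j) : ℝ)) with hX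
  have hrow (ξ : ι → ℂ) : ∑ k, ∑ j, ‖∑ i, X k i j * ξ i‖ ^ 2 ≤ 4 * ∑ i, ‖ξ i‖ ^ 2 := by
    refine sum_norm_sq_le_of_re_le (fun k j i => X k i j) (fun x y => ?_) ξ
    have h := hb₁ (fun i => x i / (√(w i) : ℝ)) (fun k j => y k j / (√(v j) : ℝ))
    have e : ∑ k, ∑ j, (∑ i, X k i j * x i) * y k j = ∑ k, (a k : ℂ) * ∑ i, ∑ j,
        M k i j * (x i / (√(w i) : ℝ)) * (y k j / (√(v j) : ℝ)) := by
      refine Finset.sum_congr rfl fun k _ => ?_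
      rw [Finset.sum_comm (s := Finset.univ (α := ι)), Finset.mul_sum]
      refine Finset.sum_congr rfl fun j _ => ?_
      rw [Finset.mul_sum, Finset.sum_mul]
      refine Finset.sum_congr rfl fun i _ => ?_
      simp only [hX, Matrix.of_apply]
      field_simp [hsw i, hsv j]
    rw [e]
    refine h.trans (add_le_add (Finset.sum_le_sum fun i _ => ?_)
      (Finset.sum_le_sum fun k _ => Finset.sum_le_sum fun j _ => ?_))
    · rw [← hscale (hw0 i) (x i)]
      exact mul_le_mul_of_nonneg_right (by have := hw₂ i; simp only [hw]; linarith)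
        (by positivity)
    · rw [← hscale (hv0 j) (y k j)]
      exact mul_le_mul_of_nonneg_right (by have := hv₂ j; simp only [hv]; linarith)
        (by positivity)
  have hcol (ξ : ι → ℂ) : ∑ k, ∑ i, ‖∑ j, X k i j * ξ j‖ ^ 2 ≤ 4 * ∑ i, ‖ξ i‖ ^ 2 := by
    refine sum_norm_sq_le_of_re_le (fun k i j => X k i j) (fun y x => ?_) ξ
    have h := hb₂ (fun j => y j / (√(v j) : ℝ)) (fun k i => x k i / (√(w i) : ℝ))
    have e : ∑ k, ∑ i, (∑ j, X k i j * y j) * x k i = ∑ k, (a k : ℂ) * ∑ j, ∑ i,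
        M k i j * (y j / (√(v j) : ℝ)) * (x k i / (√(w i) : ℝ)) := by
      refine Finset.sum_congr rfl fun k _ => ?_
      rw [Finset.sum_comm (s := Finset.univ (α := ι)), Finset.mul_sum]
      refine Finset.sum_congr rfl fun i _ => ?_
      rw [Finset.mul_sum, Finset.sum_mul]
      refine Finset.sum_congr rfl fun j _ => ?_
      simp only [hX, Matrix.of_apply]
      field_simp [hsw i, hsv j]
    rw [e]
    refine h.trans (add_le_add (Finset.sum_le_sum fun i _ => ?_)
      (Finset.sum_le_sum fun k _ => Finset.sum_le_sum fun j _ => ?_))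
    · rw [← hscale (hv0 i) (y i)]
      exact mul_le_mul_of_nonneg_right (by have := hv₁ i; simp only [hv]; linarith)
        (by positivity)
    · rw [← hscale (hw0 j) (x k j)]
      exact mul_le_mul_of_nonneg_right (by have := hw₁ j; simp only [hw]; linarith)
        (by positivity)
  have hhalf (z : ℂ) : ‖(1 / 2 : ℂ) * z‖ ^ 2 = 1 / 4 * ‖z‖ ^ 2 := by
    rw [norm_mul, mul_pow]; norm_num
  set x : Fin N → Matrix ι ι ℂ := fun k => (1 / 2 : ℂ) • X k with hx
  have hD : ∑ k, star (x k) * x k ≤ 1 := by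
    refine sum_star_mul_self_le_one x fun ξ => ?_
    have := hcol ξ
    simp only [hx, Matrix.mulVec, dotProduct, Matrix.smul_apply, smul_eq_mul, mul_assoc,
      ← Finset.mul_sum, hhalf]
    linarith
  have hR : ∑ k, x k * star (x k) ≤ 1 := by
    refine sum_mul_star_self_le_one x fun ξ => ?_
    have := hrow ξ
    simp only [hx, Matrix.mulVec, dotProduct, Matrix.transpose_apply, Matrix.smul_apply,
      smul_eq_mul, mul_assoc, ← Finset.mul_sum, hhalf]
    linarith
  set τ : Fin N → Matrix ι ι ℂ →L[ℂ] ℂ := fun k => LinearMap.toContinuousLinearMap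
    { toFun := fun g => ∑ i, ∑ j, ((√(w i) : ℝ) * (√(v j) : ℝ)) * g i j * U k i j
      map_add' := fun g g' => by
        simp only [Matrix.add_apply, mul_add, add_mul, Finset.sum_add_distrib]
      map_smul' := fun c g => by
        simp only [Matrix.smul_apply, smul_eq_mul, Finset.mul_sum, RingHom.id_apply]
        exact Finset.sum_congr rfl fun i _ => Finset.sum_congr rfl fun j _ => by ring } with hτ
  have hτa (k) (g : Matrix ι ι ℂ) :
    τ k g = ∑ i, ∑ j, ((√(w i) : ℝ) * (√(v j) : ℝ)) * g i j * U k i j := rfl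
  have key := norm_sum_le_signMean_of_row_col x hD hR τ V fun s g hg => by
    simp only [hτa]
    refine hV s (fun i j => ((√(w i) : ℝ) * (√(v j) : ℝ)) * g i j) fun x y => ?_
    have h1 := norm_matrix_bilin_le g (fun i => (√(w i) : ℝ) * x i) (fun j => (√(v j) : ℝ) * y j)
    have hsq {t : ℝ} (ht : 0 < t) (z : ℂ) : ‖((√t : ℝ) : ℂ) * z‖ ^ 2 = t * ‖z‖ ^ 2 := by
      rw [norm_mul, Complex.norm_real, Real.norm_of_nonneg (Real.sqrt_nonneg _), mul_pow,
        Real.sq_sqrt ht.le]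
    simp only [hsq (hw0 _), hsq (hv0 _)] at h1
    have e : ∑ i, ∑ j, ((√(w i) : ℝ) * (√(v j) : ℝ)) * g i j * x i * y j =
        ∑ i, ∑ j, g i j * ((√(w i) : ℝ) * x i) * ((√(v j) : ℝ) * y j) :=
      Finset.sum_congr rfl fun i _ => Finset.sum_congr rfl fun j _ => by ring
    rw [e]
    have h2 := Real.sqrt_le_sqrt (hwp x)
    have h3 := Real.sqrt_le_sqrt (hvq y)
    rw [Real.sqrt_mul (by have := khinchinConst_pos p; linarith),
      Real.sqrt_sq (lpNormFin_nonneg _)] at h2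
    rw [Real.sqrt_mul (by have := khinchinConst_pos q; linarith),
      Real.sqrt_sq (lpNormFin_nonneg _)] at h3
    have hx0 := lpNormFin_nonneg (p := p) fun i => ‖x i‖
    calc _ ≤ _ := h1
      _ ≤ 2 * (√(khinchinConst p + 1) * lpNormFin p fun i => ‖x i‖) *
          (√(khinchinConst q + 1) * lpNormFin q fun i => ‖y i‖) := by gcongr
      _ = _ := by rw [matrixCotypeConst]; ring
  have e : ∑ k, τ k (x k) = (1 / 2 : ℂ) * ∑ k, a k * ∑ i, ∑ j, M k i j * U k i j := by
    rw [Finset.mul_sum]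
    refine Finset.sum_congr rfl fun k _ => ?_
    rw [hτa, Finset.mul_sum, Finset.mul_sum]
    refine Finset.sum_congr rfl fun i _ => ?_
    rw [Finset.mul_sum, Finset.mul_sum]
    refine Finset.sum_congr rfl fun j _ => ?_
    simp only [hx, hX, Matrix.smul_apply, Matrix.of_apply, smul_eq_mul]
    have := hsw i
    have := hsv j
    field_simp
  rw [e, norm_mul] at key
  norm_num at key
  linarith

end Square

/-! ### Finite rank approximation on `L_p` -/

section Blocks

open scoped Function

lemma sum_indicator_eq_of_mem {S ι E : Type*} [Fintype ι] [AddCommMonoid E] {A : ι → Set S}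
    (hd : Pairwise (Disjoint on A))
    (g : ι → S → E) {s : S} {i : ι} (hs : s ∈ A i) :
    ∑ k, (A k).indicator (g k) s = g i s := by
  rw [Finset.sum_eq_single i, Set.indicator_of_mem hs]
  · intro k _ hk
    exact Set.indicator_of_notMem (fun h => Set.disjoint_left.1 (hd hk) h hs) _
  · simp

variable {S ι : Type*} [MeasurableSpace S] {μ : Measure S} {p : ℝ≥0∞} [Fintype ι]
  {A : ι → Set S}

lemma eLpNorm_rpow_toReal_eq [Fact (1 ≤ p)] (hp : p ≠ ∞) {f : S → ℂ} (ν : Measure S) :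
    eLpNorm f p ν ^ p.toReal = ∫⁻ s, ‖f s‖ₑ ^ p.toReal ∂ν := by
  have h0 : p ≠ 0 := (zero_lt_one.trans_le (Fact.out : 1 ≤ p)).ne'
  rw [eLpNorm_eq_lintegral_rpow_enorm_toReal h0 hp, ← ENNReal.rpow_mul,
    one_div_mul_cancel (ENNReal.toReal_pos h0 hp).ne', ENNReal.rpow_one]

/-- The normalized indicator functions of sets of finite measure. -/
noncomputable def blockVec (p : ℝ≥0∞) (hA : ∀ i, MeasurableSet (A i)) (ht : ∀ i, μ (A i) ≠ ∞)
    (i : ι) : Lp ℂ p μ :=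
  indicatorConstLp p (hA i) (ht i) ((μ.real (A i) ^ (-(1 / p.toReal)) : ℝ) : ℂ)

lemma coeFn_sum_smul_blockVec (hA : ∀ i, MeasurableSet (A i)) (ht : ∀ i, μ (A i) ≠ ∞)
    (c : ι → ℂ) :
    ⇑(∑ i, c i • blockVec p hA ht i) =ᵐ[μ] fun s => ∑ i, (A i).indicator
      (fun _ => c i * ((μ.real (A i) ^ (-(1 / p.toReal)) : ℝ) : ℂ)) s := by
  have h1 : ∀ᵐ s ∂μ, ∀ i, (c i • blockVec p hA ht i : Lp ℂ p μ) s = c i * (A i).indicator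
      (fun _ => ((μ.real (A i) ^ (-(1 / p.toReal)) : ℝ) : ℂ)) s := by
    rw [ae_all_iff]
    intro i
    filter_upwards [Lp.coeFn_smul (c i) (blockVec p hA ht i),
      indicatorConstLp_coeFn (p := p) (hs := hA i) (hμs := ht i)
        (c := ((μ.real (A i) ^ (-(1 / p.toReal)) : ℝ) : ℂ))] with s h1 h2
    rw [h1, Pi.smul_apply, smul_eq_mul, blockVec, h2]
  filter_upwards [h1, Lp.coeFn_fun_finsetSum Finset.univ fun i => c i • blockVec p hA ht i]
    with s h1 h2
  rw [h2]
  refine Finset.sum_congr rfl fun i _ => ?_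
  rw [h1]
  by_cases hs : s ∈ A i <;> simp [hs]

variable [Fact (1 ≤ p)]

lemma norm_sum_smul_blockVec_le (hp : p ≠ ∞) (hA : ∀ i, MeasurableSet (A i))
    (hd : Pairwise (Disjoint on A)) (h0 : ∀ i, μ (A i) ≠ 0) (ht : ∀ i, μ (A i) ≠ ∞) (c : ι → ℂ) :
    ‖∑ i, c i • blockVec p hA ht i‖ ≤ lpNormFin p.toReal (fun i => ‖c i‖) := by
  have hp0 : 0 < p.toReal :=
    ENNReal.toReal_pos (zero_lt_one.trans_le (Fact.out : 1 ≤ p)).ne' hp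
  have hm (i) : 0 < μ.real (A i) := ENNReal.toReal_pos (h0 i) (ht i)
  rw [Lp.norm_def]
  refine ENNReal.toReal_le_of_le_ofReal (lpNormFin_nonneg _) ?_
  rw [← ENNReal.rpow_le_rpow_iff hp0, eLpNorm_congr_ae (coeFn_sum_smul_blockVec hA ht c),
    eLpNorm_rpow_toReal_eq hp, ENNReal.ofReal_rpow_of_nonneg (lpNormFin_nonneg _) hp0.le,
    lpNormFin_rpow hp0]
  have e (s : S) : ‖∑ i, (A i).indicator
      (fun _ => c i * ((μ.real (A i) ^ (-(1 / p.toReal)) : ℝ) : ℂ)) s‖ₑ ^ p.toReal =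
      ∑ i, (A i).indicator (fun _ => ‖c i * ((μ.real (A i) ^ (-(1 / p.toReal)) : ℝ) : ℂ)‖ₑ
        ^ p.toReal) s := by
    by_cases hs : ∃ i, s ∈ A i
    · obtain ⟨i, hs⟩ := hs
      rw [sum_indicator_eq_of_mem hd _ hs, sum_indicator_eq_of_mem hd _ hs]
    · push Not at hs
      simp [Set.indicator_of_notMem (hs _), ENNReal.zero_rpow_of_pos hp0]
  simp only [e]
  rw [lintegral_finsetSum _ fun i _ => measurable_const.indicator (hA i),
    ENNReal.ofReal_sum_of_nonneg fun i _ => by positivity]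
  refine Finset.sum_le_sum fun i _ => le_of_eq ?_
  rw [lintegral_indicator_const (hA i), ← ofReal_norm, norm_mul, Complex.norm_real,
    Real.norm_of_nonneg (by positivity), ENNReal.ofReal_rpow_of_nonneg (by positivity) hp0.le,
    ← ofReal_measureReal (ht i), ← ENNReal.ofReal_mul (by positivity), abs_norm,
    Real.mul_rpow (by positivity) (by positivity), ← Real.rpow_mul (hm i).le, neg_mul,
    one_div_mul_cancel hp0.ne', Real.rpow_neg_one, mul_assoc, inv_mul_cancel₀ (hm i).ne', mul_one]

lemma integrableOn_of_Lp {T : Set S} (ht : μ T ≠ ∞) (x : Lp ℂ p μ) :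
    IntegrableOn x T μ := by
  have := Fact.mk ht.lt_top
  exact ((Lp.memLp x).restrict T).integrable Fact.out

lemma enorm_average_le {T : Set S} (h0 : μ T ≠ 0) (ht : μ T ≠ ∞) (x : Lp ℂ p μ) :
    ‖((μ.real T ^ (1 / p.toReal - 1) : ℝ) : ℂ) * ∫ s in T, x s ∂μ‖ₑ ≤
      eLpNorm x p (μ.restrict T) := by
  have hm : 0 < μ.real T := ENNReal.toReal_pos h0 ht
  have h1 := eLpNorm_le_eLpNorm_mul_rpow_measure_univ (μ := μ.restrict T) (Fact.out : 1 ≤ p)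
    (Lp.aestronglyMeasurable x).restrict
  rw [eLpNorm_one_eq_lintegral_enorm, Measure.restrict_apply_univ] at h1
  have h2 := (enorm_integral_le_lintegral_enorm (μ := μ.restrict T) x).trans h1
  rw [enorm_mul]
  refine (mul_le_mul_right h2 _).trans (le_of_eq ?_)
  rw [mul_left_comm, ← ofReal_norm, Complex.norm_real, Real.norm_of_nonneg (by positivity),
    ← ofReal_measureReal ht, ENNReal.ofReal_rpow_of_pos hm, ← ENNReal.ofReal_mul (by positivity),
    ← Real.rpow_add hm]
  simp

/-- Normalized integration over a set, as a functional on `L_p`. -/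
noncomputable def blockFun (h0 : ∀ i, μ (A i) ≠ 0) (ht : ∀ i, μ (A i) ≠ ∞)
    (i : ι) : Lp ℂ p μ →L[ℂ] ℂ :=
  LinearMap.mkContinuous
    { toFun := fun x => ((μ.real (A i) ^ (1 / p.toReal - 1) : ℝ) : ℂ) * ∫ s in A i, x s ∂μ
      map_add' := fun x y => by
        rw [← mul_add, ← integral_add (integrableOn_of_Lp (ht i) x) (integrableOn_of_Lp (ht i) y)]
        congr 1
        exact integral_congr_ae (ae_restrict_of_ae (Lp.coeFn_add x y))
      map_smul' := fun c x => by
        rw [integral_congr_ae (ae_restrict_of_ae (Lp.coeFn_smul c x))]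
        simp only [Pi.smul_apply, smul_eq_mul, integral_const_mul, RingHom.id_apply]
        ring } 1 fun x => by
    rw [one_mul, Lp.norm_def, ← toReal_enorm]
    exact ENNReal.toReal_mono (Lp.eLpNorm_ne_top x) ((enorm_average_le (h0 i) (ht i) x).trans
      (eLpNorm_mono_measure _ Measure.restrict_le_self))

lemma lpNormFin_blockFun_le (hp : p ≠ ∞) (hA : ∀ i, MeasurableSet (A i))
    (hd : Pairwise (Disjoint on A)) (h0 : ∀ i, μ (A i) ≠ 0) (ht : ∀ i, μ (A i) ≠ ∞)
    (x : Lp ℂ p μ) : lpNormFin p.toReal (fun i => ‖blockFun h0 ht i x‖) ≤ ‖x‖ := by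
  have hp0 : 0 < p.toReal :=
    ENNReal.toReal_pos (zero_lt_one.trans_le (Fact.out : 1 ≤ p)).ne' hp
  rw [lpNormFin_le_iff hp0 _ (norm_nonneg _), ← ENNReal.ofReal_le_ofReal_iff (by positivity),
    ENNReal.ofReal_sum_of_nonneg fun i _ => by positivity]
  have h1 (i : ι) : ENNReal.ofReal (|‖blockFun h0 ht i x‖| ^ p.toReal) ≤
      ∫⁻ s in A i, ‖x s‖ₑ ^ p.toReal ∂μ := by
    rw [abs_norm, ← ENNReal.ofReal_rpow_of_nonneg (norm_nonneg _) hp0.le, ofReal_norm,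
      ← eLpNorm_rpow_toReal_eq hp]
    exact ENNReal.rpow_le_rpow (enorm_average_le (h0 i) (ht i) x) hp0.le
  refine (Finset.sum_le_sum fun i _ => h1 i).trans ?_
  rw [← lintegral_biUnion_finset (fun i _ j _ hij => hd hij) fun i _ => hA i,
    ← ENNReal.ofReal_rpow_of_nonneg (norm_nonneg _) hp0.le, Lp.norm_def,
    ENNReal.ofReal_toReal (Lp.eLpNorm_ne_top x), eLpNorm_rpow_toReal_eq hp]
  exact setLIntegral_le_lintegral _ _

lemma blockFun_sum_smul_blockVec (hA : ∀ i, MeasurableSet (A i))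
    (hd : Pairwise (Disjoint on A)) (h0 : ∀ i, μ (A i) ≠ 0) (ht : ∀ i, μ (A i) ≠ ∞)
    (c : ι → ℂ) (i : ι) : blockFun h0 ht i (∑ k, c k • blockVec p hA ht k) = c i := by
  have hm : 0 < μ.real (A i) := ENNReal.toReal_pos (h0 i) (ht i)
  have e : ∫ s in A i, (∑ k, c k • blockVec p hA ht k : Lp ℂ p μ) s ∂μ =
      ∫ s in A i, c i * ((μ.real (A i) ^ (-(1 / p.toReal)) : ℝ) : ℂ) ∂μ := by
    refine integral_congr_ae ?_
    filter_upwards [ae_restrict_of_ae (coeFn_sum_smul_blockVec (p := p) hA ht c),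
      ae_restrict_mem (hA i)] with s h1 h2
    rw [h1, sum_indicator_eq_of_mem hd _ h2]
  have h1 : μ.real (A i) ^ (1 / p.toReal - 1) * μ.real (A i) *
      μ.real (A i) ^ (-(1 / p.toReal)) = 1 := by
    rw [← Real.rpow_add_one hm.ne', ← Real.rpow_add hm]
    simp
  rw [show blockFun h0 ht i _ = ((μ.real (A i) ^ (1 / p.toReal - 1) : ℝ) : ℂ) * ∫ s in A i, _ ∂μ
    from rfl, e, setIntegral_const, Complex.real_smul]
  have h2 := congrArg (fun t : ℝ => (t : ℂ)) h1
  simp only [Complex.ofReal_mul, Complex.ofReal_one] at h2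
  linear_combination (c i) * h2

end Blocks

section Approximation

open scoped Function

variable {S : Type*} [MeasurableSpace S] {μ : Measure S} {p : ℝ≥0∞} [Fact (1 ≤ p)]

/-- Finitely many elements of `L_p` are approximated by combinations of finitely many normalized
indicator functions of disjoint sets. -/
lemma exists_sum_smul_blockVec_near (hp : p ≠ ∞) {κ : Type*} [Fintype κ] (x : κ → Lp ℂ p μ) {δ : ℝ}
    (hδ : 0 < δ) : ∃ (T : Finset (κ → ℂ)) (A : T → Set S) (hA : ∀ i, MeasurableSet (A i))
      (_ : Pairwise (Disjoint on A)) (_ : ∀ i, μ (A i) ≠ 0) (ht : ∀ i, μ (A i) ≠ ∞)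
      (b : κ → T → ℂ), ∀ l, ‖x l - ∑ i, b l i • blockVec p hA ht i‖ ≤ δ := by
  classical
  have h0 : p ≠ 0 := (zero_lt_one.trans_le (Fact.out : 1 ≤ p)).ne'
  have hF : MemLp (fun s l => x l s) p μ := memLp_pi_iff.2 fun l => Lp.memLp (x l)
  obtain ⟨g, hg, hgm⟩ := hF.exists_simpleFunc_eLpNorm_sub_lt hp
    (ENNReal.ofReal_pos.2 hδ).ne'
  set T := g.range.filter fun c => c ≠ 0 ∧ μ (g ⁻¹' {c}) ≠ 0 with hT
  have hA (i : T) : MeasurableSet (g ⁻¹' {i.1}) := g.measurableSet_fiber _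
  have hd : Pairwise (Disjoint on fun i : T => g ⁻¹' {i.1}) := fun i j hij =>
    Disjoint.preimage _ (Set.disjoint_singleton.2 fun h => hij (Subtype.ext h))
  have ht (i : T) : μ (g ⁻¹' {i.1}) ≠ ∞ :=
    (SimpleFunc.measure_preimage_lt_top_of_memLp h0 hp g hgm i.1
      (Finset.mem_filter.1 i.2).2.1).ne
  have hm (i : T) : μ (g ⁻¹' {i.1}) ≠ 0 := (Finset.mem_filter.1 i.2).2.2
  refine ⟨T, fun i => g ⁻¹' {i.1}, hA, hd, hm, ht,
    fun l i => i.1 l * ((μ.real (g ⁻¹' {i.1}) ^ (1 / p.toReal) : ℝ) : ℂ), fun l => ?_⟩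
  have hnull : ∀ᵐ s ∂μ, μ (g ⁻¹' {g s}) ≠ 0 := by
    have : ∀ᵐ s ∂μ, ∀ c ∈ g.range, μ (g ⁻¹' {c}) = 0 → s ∉ g ⁻¹' {c} := by
      rw [Filter.eventually_all_finset]
      intro c _
      by_cases hc : μ (g ⁻¹' {c}) = 0
      · filter_upwards [measure_eq_zero_iff_ae_notMem.1 hc] with s hs _ using hs
      · exact Eventually.of_forall fun s h => absurd h hc
    filter_upwards [this] with s hs h
    exact hs (g s) (g.mem_range_self s) h rfl
  rw [Lp.norm_def]
  refine ENNReal.toReal_le_of_le_ofReal hδ.le (le_trans (eLpNorm_mono_ae ?_) hg.le)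
  filter_upwards [hnull, Lp.coeFn_sub (x l) (∑ i : T, (i.1 l *
    ((μ.real (g ⁻¹' {i.1}) ^ (1 / p.toReal) : ℝ) : ℂ)) • blockVec p hA ht i),
    coeFn_sum_smul_blockVec (p := p) hA ht fun i => i.1 l *
    ((μ.real (g ⁻¹' {i.1}) ^ (1 / p.toReal) : ℝ) : ℂ)] with s hs h1 h2
  have h3 : ∑ i : T, (g ⁻¹' {i.1}).indicator (fun _ => i.1 l *
      ((μ.real (g ⁻¹' {i.1}) ^ (1 / p.toReal) : ℝ) : ℂ) *
      ((μ.real (g ⁻¹' {i.1}) ^ (-(1 / p.toReal)) : ℝ) : ℂ)) s = g s l := by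
    by_cases hz : g s = 0
    · rw [hz, Pi.zero_apply]
      refine Finset.sum_eq_zero fun i _ => Set.indicator_of_notMem (fun h => ?_) _
      exact (Finset.mem_filter.1 i.2).2.1 (by rw [← hz]; exact h.symm)
    · have hi : g s ∈ T := Finset.mem_filter.2 ⟨g.mem_range_self s, hz, hs⟩
      have hpos : 0 < μ.real (g ⁻¹' {g s}) := ENNReal.toReal_pos (hm ⟨g s, hi⟩) (ht ⟨g s, hi⟩)
      rw [sum_indicator_eq_of_mem hd _ (i := ⟨g s, hi⟩) rfl, mul_assoc, ← Complex.ofReal_mul,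
        ← Real.rpow_add hpos]
      simp
  rw [h1, Pi.sub_apply, h2, h3]
  exact norm_le_pi_norm ((fun l => x l s) - g s) l

/-- Finitely many elements of `L_p` are almost fixed by a contraction that factors through a
finite-dimensional `ℓ_p` space. -/
lemma exists_finite_rank_approx (hp : p ≠ ∞) {κ : Type*} [Fintype κ] (x : κ → Lp ℂ p μ) {δ : ℝ}
    (hδ : 0 < δ) : ∃ (T : Finset (κ → ℂ)) (e : T → Lp ℂ p μ) (f : T → Lp ℂ p μ →L[ℂ] ℂ),
      (∀ c : T → ℂ, ‖∑ i, c i • e i‖ ≤ lpNormFin p.toReal (fun i => ‖c i‖)) ∧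
      (∀ y, lpNormFin p.toReal (fun i => ‖f i y‖) ≤ ‖y‖) ∧
      ∀ l, ‖∑ i, f i (x l) • e i - x l‖ ≤ δ := by
  obtain ⟨T, A, hA, hd, h0, ht, b, hb⟩ := exists_sum_smul_blockVec_near hp x (half_pos hδ)
  refine ⟨T, blockVec p hA ht, blockFun h0 ht, norm_sum_smul_blockVec_le hp hA hd h0 ht,
    lpNormFin_blockFun_le hp hA hd h0 ht, fun l => ?_⟩
  set g := ∑ i, b l i • blockVec p hA ht i with hg
  have e : ∑ i, blockFun h0 ht i (x l) • blockVec p hA ht i - x l =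
      ∑ i, blockFun h0 ht i (x l - g) • blockVec p hA ht i - (x l - g) := by
    simp only [map_sub, sub_smul, Finset.sum_sub_distrib, hg,
      blockFun_sum_smul_blockVec hA hd h0 ht]
    abel
  rw [e]
  have h1 := norm_sum_smul_blockVec_le hp hA hd h0 ht fun i => blockFun h0 ht i (x l - g)
  have h2 := lpNormFin_blockFun_le hp hA hd h0 ht (x l - g)
  have h3 := hb l
  refine (norm_sub_le _ _).trans ?_
  linarith

end Approximation

/-! ### Cotype of the projective tensor product -/

/-- A map of the form `y ↦ ∑ᵢ fᵢ(y) eᵢ` that factors contractively through `ℓ_p`. -/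
structure IsLpFactorization {ι E : Type*} [Fintype ι] [NormedAddCommGroup E] [NormedSpace ℂ E]
    (p : ℝ) (e : ι → E) (f : ι → E →L[ℂ] ℂ) : Prop where
  norm_sum_le : ∀ c : ι → ℂ, ‖∑ i, c i • e i‖ ≤ lpNormFin p (fun i => ‖c i‖)
  lpNorm_le : ∀ y, lpNormFin p (fun i => ‖f i y‖) ≤ ‖y‖

section Factorization

variable {ι κ E : Type*} [Fintype ι] [Fintype κ] [NormedAddCommGroup E] [NormedSpace ℂ E] {p : ℝ}
  {e : ι → E} {f : ι → E →L[ℂ] ℂ}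

lemma IsLpFactorization.sumElim_zero (hp : 0 < p) (h : IsLpFactorization p e f) :
    IsLpFactorization p (Sum.elim e fun _ : κ => 0) (Sum.elim f fun _ : κ => 0) where
  norm_sum_le c := by
    simp only [Fintype.sum_sum_type, Sum.elim_inl, Sum.elim_inr, smul_zero, Finset.sum_const_zero,
      add_zero]
    refine (h.norm_sum_le fun i => c (Sum.inl i)).trans ?_
    rw [lpNormFin_le_iff hp _ (lpNormFin_nonneg _), lpNormFin_rpow hp, Fintype.sum_sum_type]
    exact le_add_of_nonneg_right (Finset.sum_nonneg fun _ _ => by positivity)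
  lpNorm_le y := by
    refine le_trans (le_of_eq ?_) (h.lpNorm_le y)
    simp [lpNormFin, Fintype.sum_sum_type, Real.zero_rpow hp.ne']

lemma IsLpFactorization.zero_sumElim (hp : 0 < p) (h : IsLpFactorization p e f) :
    IsLpFactorization p (Sum.elim (fun _ : κ => 0) e) (Sum.elim (fun _ : κ => 0) f) where
  norm_sum_le c := by
    simp only [Fintype.sum_sum_type, Sum.elim_inl, Sum.elim_inr, smul_zero, Finset.sum_const_zero,
      zero_add]
    refine (h.norm_sum_le fun i => c (Sum.inr i)).trans ?_
    rw [lpNormFin_le_iff hp _ (lpNormFin_nonneg _), lpNormFin_rpow hp, Fintype.sum_sum_type]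
    exact le_add_of_nonneg_left (Finset.sum_nonneg fun _ _ => by positivity)
  lpNorm_le y := by
    refine le_trans (le_of_eq ?_) (h.lpNorm_le y)
    simp [lpNormFin, Fintype.sum_sum_type, Real.zero_rpow hp.ne']

end Factorization

lemma exists_norming_weights {r : ℝ} (hr : 1 < r) {N : ℕ} {t : Fin N → ℝ} (ht : ∀ k, 0 ≤ t k) :
    ∃ a : Fin N → ℝ, (∀ k, 0 ≤ a k) ∧ ∑ k, a k * t k = lpNormFin r t ∧
      ∀ b : Fin N → ℝ, (∀ k, 0 ≤ b k) → ∑ k, a k * b k ≤ lpNormFin r b := by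
  have hc := Real.HolderConjugate.conjExponent hr
  lift t to Fin N → NNReal using ht
  obtain ⟨⟨g, hg, hgt⟩, -⟩ := NNReal.isGreatest_Lp Finset.univ t hc
  refine ⟨fun k => g k, fun k => (g k).2, ?_, fun b hb => ?_⟩
  · have := congrArg (fun z : NNReal => (z : ℝ)) hgt
    simp only [NNReal.coe_sum, NNReal.coe_mul, NNReal.coe_rpow] at this
    simp only [lpNormFin, NNReal.abs_eq, ← this]
    exact Finset.sum_congr rfl fun k _ => mul_comm _ _
  · lift b to Fin N → NNReal using hb
    have h1 := NNReal.inner_le_Lp_mul_Lq Finset.univ b g hc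
    have h2 : (∑ k, g k ^ r.conjExponent) ^ (1 / r.conjExponent) ≤ 1 :=
      NNReal.rpow_le_one hg (by have := hc.symm.pos; positivity)
    have h3 := NNReal.coe_le_coe.2 (h1.trans (mul_le_of_le_one_right zero_le h2))
    simp only [NNReal.coe_sum, NNReal.coe_mul, NNReal.coe_rpow] at h3
    simp only [lpNormFin, NNReal.abs_eq]
    refine le_trans (le_of_eq ?_) h3
    exact Finset.sum_congr rfl fun k _ => mul_comm _ _

section ProjectiveTensor

variable {E F B : Type*} [NormedAddCommGroup E] [NormedSpace ℂ E] [NormedAddCommGroup F]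
  [NormedSpace ℂ F] [NormedAddCommGroup B] [NormedSpace ℂ B] {j : E →L[ℂ] F →L[ℂ] B} {p q r : ℝ}

lemma exists_functional_of_matrix (hj : IsProjTensor j) {ι : Type*} [Fintype ι]
    {e : ι → E} {f : ι → E →L[ℂ] ℂ} (hf : IsLpFactorization p e f)
    {e' : ι → F} {f' : ι → F →L[ℂ] ℂ} (hf' : IsLpFactorization q e' f') {G : ι → ι → ℂ} {K : ℝ}
    (hK : 0 ≤ K) (hG : ∀ x y : ι → ℂ, ‖∑ i, ∑ j, G i j * x i * y j‖ ≤
      K * (lpNormFin p (fun i => ‖x i‖) * lpNormFin q (fun j => ‖y j‖))) :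
    ∃ Φ : B →L[ℂ] ℂ, ‖Φ‖ ≤ K ∧
      ∀ x y, Φ (j x y) = ∑ i, ∑ j, G i j * f i x * f' j y := by
  set Γ : E →L[ℂ] F →L[ℂ] ℂ := ∑ i, ∑ j, (f i).smulRight (G i j • f' j) with hΓ
  have e1 (x : E) (y : F) : Γ x y = ∑ i, ∑ j, G i j * f i x * f' j y := by
    simp only [hΓ, sum_apply, ContinuousLinearMap.smulRight_apply,
      smul_apply, smul_eq_mul]
    exact Finset.sum_congr rfl fun i _ => Finset.sum_congr rfl fun j _ => by ring
  obtain ⟨Φ, hΦ, hΦj⟩ := hj.lift Γ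
  refine ⟨Φ, hΦ.trans (Γ.opNorm_le_bound₂ hK fun x y => ?_), fun x y => (hΦj x y).trans (e1 x y)⟩
  rw [e1]
  refine (hG (fun i => f i x) fun j => f' j y).trans ?_
  rw [mul_assoc]
  exact mul_le_mul_of_nonneg_left
    (mul_le_mul (hf.lpNorm_le x) (hf'.lpNorm_le y) (lpNormFin_nonneg _) (norm_nonneg _)) hK

lemma norm_sum_factorization_le (hj : IsProjTensor j) (hp : 2 ≤ p) (hq : 2 ≤ q) (hpr : p ≤ r)
    (hqr : q ≤ r) {ι κ : Type*} [Fintype ι] [Fintype κ]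
    {e : ι → E} {f : ι → E →L[ℂ] ℂ} (hf : IsLpFactorization p e f)
    {e' : ι → F} {f' : ι → F →L[ℂ] ℂ} (hf' : IsLpFactorization q e' f')
    {N : ℕ} (c : Fin N → κ → ℂ) (x : κ → E) (y : κ → F)
    {Ψ : Fin N → B →L[ℂ] ℂ} (hΨ : ∀ k, ‖Ψ k‖ ≤ 1) {a : Fin N → ℝ} (ha0 : ∀ k, 0 ≤ a k)
    (ha : ∀ t : Fin N → ℝ, (∀ k, 0 ≤ t k) → ∑ k, a k * t k ≤ lpNormFin r t) :
    ‖∑ k, a k * Ψ k (∑ l, c k l • j (∑ i, f i (x l) • e i) (∑ i, f' i (y l) • e' i))‖ ≤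
      2 * matrixCotypeConst p q * signMean fun s =>
        ‖signSum (fun k => ∑ l, c k l • j (x l) (y l)) s‖ := by
  have hK : 0 ≤ matrixCotypeConst p q := by unfold matrixCotypeConst; positivity
  have expand (z w : ι → ℂ) : j (∑ i, z i • e i) (∑ i, w i • e' i) =
      ∑ i, ∑ i', (z i * w i') • j (e i) (e' i') := by
    simp only [map_sum, map_smul, sum_apply, smul_apply,
      Finset.smul_sum, smul_smul]
    rw [Finset.sum_comm]
    exact Finset.sum_congr rfl fun i _ => Finset.sum_congr rfl fun i' _ => by rw [mul_comm]
  have key := norm_sum_smul_pairing_le hp hq hpr hqr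
    (fun k i i' => Ψ k (j (e i) (e' i'))) (fun k z w => ?_) ha0 ha
    (fun k i i' => ∑ l, c k l * f i (x l) * f' i' (y l))
    (fun s => matrixCotypeConst p q * ‖signSum (fun k => ∑ l, c k l • j (x l) (y l)) s‖)
    (fun s G hG => ?_)
  · refine le_trans (le_of_eq ?_) (key.trans (le_of_eq ?_))
    · congr 1
      refine Finset.sum_congr rfl fun k _ => ?_
      congr 1
      simp only [expand]
      simp only [map_sum, map_smul, smul_eq_mul, Finset.mul_sum]
      rw [Finset.sum_comm]
      refine Finset.sum_congr rfl fun i _ => ?_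
      rw [Finset.sum_comm]
      exact Finset.sum_congr rfl fun i' _ => Finset.sum_congr rfl fun l _ => by ring
    · have := signMean_smul (matrixCotypeConst p q) fun s =>
        ‖signSum (fun k => ∑ l, c k l • j (x l) (y l)) s‖
      simp only [smul_eq_mul] at this
      rw [this, mul_assoc]
  · have e1 : ∑ i, ∑ i', Ψ k (j (e i) (e' i')) * z i * w i' =
        Ψ k (j (∑ i, z i • e i) (∑ i, w i • e' i)) := by
      rw [expand]
      simp only [map_sum, map_smul, smul_eq_mul]
      exact Finset.sum_congr rfl fun i _ => Finset.sum_congr rfl fun i' _ => by ring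
    rw [e1]
    calc _ ≤ ‖Ψ k‖ * ‖j (∑ i, z i • e i) (∑ i, w i • e' i)‖ := (Ψ k).le_opNorm _
      _ ≤ 1 * ‖j (∑ i, z i • e i) (∑ i, w i • e' i)‖ :=
        mul_le_mul_of_nonneg_right (hΨ k) (norm_nonneg _)
      _ ≤ ‖∑ i, z i • e i‖ * ‖∑ i, w i • e' i‖ := by rw [one_mul]; exact hj.norm_le _ _
      _ ≤ _ := mul_le_mul (hf.norm_sum_le z) (hf'.norm_sum_le w) (norm_nonneg _)
        (lpNormFin_nonneg _)
  · obtain ⟨Φ, hΦ, hΦj⟩ := exists_functional_of_matrix hj hf hf' hK hG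
    have e1 : ∑ k, boolSign (s k) • ∑ i, ∑ i', G i i' * ∑ l, c k l * f i (x l) * f' i' (y l) =
        Φ (signSum (fun k => ∑ l, c k l • j (x l) (y l)) s) := by
      rw [signSum, map_sum]
      refine Finset.sum_congr rfl fun k _ => ?_
      rw [Φ.map_smul_of_tower, map_sum]
      congr 1
      simp only [map_smul, hΦj, smul_eq_mul, Finset.mul_sum]
      symm
      rw [Finset.sum_comm]
      refine Finset.sum_congr rfl fun i _ => ?_
      rw [Finset.sum_comm]
      exact Finset.sum_congr rfl fun i' _ => Finset.sum_congr rfl fun l _ => by ring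
    rw [e1]
    exact (Φ.le_opNorm _).trans (mul_le_mul_of_nonneg_right hΦ (norm_nonneg _))

lemma lpNormFin_norm_le_of_approx (hj : IsProjTensor j) (hp : 2 ≤ p) (hq : 2 ≤ q) (hpr : p ≤ r)
    (hqr : q ≤ r) {κ : Type*} [Fintype κ] {N : ℕ} (c : Fin N → κ → ℂ) (x : κ → E) (y : κ → F)
    (hx : ∀ δ : ℝ, 0 < δ → ∃ (T : Finset (κ → ℂ)) (e : T → E) (f : T → E →L[ℂ] ℂ),
      IsLpFactorization p e f ∧ ∀ l, ‖∑ i, f i (x l) • e i - x l‖ ≤ δ)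
    (hy : ∀ δ : ℝ, 0 < δ → ∃ (T : Finset (κ → ℂ)) (e : T → F) (f : T → F →L[ℂ] ℂ),
      IsLpFactorization q e f ∧ ∀ l, ‖∑ i, f i (y l) • e i - y l‖ ≤ δ) :
    lpNormFin r (fun k => ‖∑ l, c k l • j (x l) (y l)‖) ≤
      2 * matrixCotypeConst p q * signMean fun s =>
        ‖signSum (fun k => ∑ l, c k l • j (x l) (y l)) s‖ := by
  have hp0 : 0 < p := by linarith
  have hq0 : 0 < q := by linarith
  obtain ⟨a, ha0, hat, ha⟩ := exists_norming_weights (by linarith : 1 < r)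
    fun k => norm_nonneg (∑ l, c k l • j (x l) (y l))
  choose Ψ hΨ hΨu using fun k => exists_dual_vector'' ℂ (∑ l, c k l • j (x l) (y l))
  set W := 2 * matrixCotypeConst p q * signMean fun s =>
    ‖signSum (fun k => ∑ l, c k l • j (x l) (y l)) s‖ with hW
  let D : Set ((κ → E) × (κ → F)) :=
    {z | ‖∑ k, a k * Ψ k (∑ l, c k l • j (z.1 l) (z.2 l))‖ ≤ W}
  have hD : IsClosed D := by
    refine isClosed_le ?_ continuous_const
    have h2 : Continuous fun w : E × F => j w.1 w.2 :=
      (j.continuous.comp continuous_fst).clm_apply continuous_snd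
    have h3 (l : κ) : Continuous fun z : (κ → E) × (κ → F) => j (z.1 l) (z.2 l) :=
      h2.comp (g := fun w : E × F => j w.1 w.2) (f := fun z : (κ → E) × (κ → F) => (z.1 l, z.2 l))
        (((continuous_apply l).comp continuous_fst).prodMk
          ((continuous_apply l).comp continuous_snd))
    fun_prop
  have hmem : (x, y) ∈ D := by
    refine hD.closure_subset (Metric.mem_closure_iff.2 fun δ hδ => ?_)
    obtain ⟨T, e, f, hf, hfx⟩ := hx (δ / 2) (half_pos hδ)
    obtain ⟨T', e', f', hf', hfy⟩ := hy (δ / 2) (half_pos hδ)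
    refine ⟨(fun l => ∑ i, f i (x l) • e i, fun l => ∑ i, f' i (y l) • e' i), ?_, ?_⟩
    · change ‖∑ k, (a k : ℂ) * Ψ k (∑ l, c k l • j (∑ i, f i (x l) • e i)
        (∑ i, f' i (y l) • e' i))‖ ≤ W
      have := norm_sum_factorization_le hj hp hq hpr hqr (hf.sumElim_zero (κ := T') hp0)
        (hf'.zero_sumElim (κ := T) hq0) c x y hΨ ha0 ha
      simpa only [Fintype.sum_sum_type, Sum.elim_inl, Sum.elim_inr, smul_zero,
        Finset.sum_const_zero, add_zero, zero_add] using this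
    · rw [Prod.dist_eq, max_lt_iff, dist_pi_lt_iff hδ, dist_pi_lt_iff hδ]
      refine ⟨fun l => ?_, fun l => ?_⟩
      · rw [dist_comm, dist_eq_norm]
        exact (hfx l).trans_lt (half_lt_self hδ)
      · rw [dist_comm, dist_eq_norm]
        exact (hfy l).trans_lt (half_lt_self hδ)
  have h1 : ‖∑ k, (a k : ℂ) * Ψ k (∑ l, c k l • j (x l) (y l))‖ ≤ W := hmem
  rw [← hat]
  refine le_trans (le_trans (le_abs_self _) (le_of_eq ?_)) h1
  simp only [hΨu]
  rw [← Real.norm_eq_abs, ← Complex.norm_real]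
  push_cast
  rfl

end ProjectiveTensor

lemma exists_isLpFactorization_approx {S : Type*} [MeasurableSpace S] {μ : Measure S} {p : ℝ≥0∞}
    [Fact (1 ≤ p)] (hp : p ≠ ∞) {κ : Type*} [Fintype κ] (x : κ → Lp ℂ p μ) {δ : ℝ} (hδ : 0 < δ) :
    ∃ (T : Finset (κ → ℂ)) (e : T → Lp ℂ p μ) (f : T → Lp ℂ p μ →L[ℂ] ℂ),
      IsLpFactorization p.toReal e f ∧ ∀ l, ‖∑ i, f i (x l) • e i - x l‖ ≤ δ := by
  obtain ⟨T, e, f, h1, h2, h3⟩ := exists_finite_rank_approx hp x hδ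
  exact ⟨T, e, f, ⟨h1, h2⟩, h3⟩

lemma exists_common_representation {E F B : Type*} [NormedAddCommGroup E] [NormedSpace ℂ E]
    [NormedAddCommGroup F] [NormedSpace ℂ F] [NormedAddCommGroup B] [NormedSpace ℂ B]
    {j : E →L[ℂ] F →L[ℂ] B} {N : ℕ} {u : Fin N → B}
    (hu : ∀ k, u k ∈ Submodule.span ℂ (Set.range fun w : E × F => j w.1 w.2)) :
    ∃ (T : Finset (E × F)) (c : Fin N → T → ℂ), ∀ k, u k = ∑ l, c k l • j l.1.1 l.1.2 := by
  classical
  choose c hc using fun k => Finsupp.mem_span_range_iff_exists_finsupp.1 (hu k)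
  refine ⟨Finset.univ.biUnion fun k => (c k).support, fun k l => c k l, fun k => ?_⟩
  rw [← hc k, Finset.sum_coe_sort _ fun l : E × F => c k l • j l.1 l.2]
  refine Finsupp.sum_of_support_subset _ ?_ _ fun _ _ => zero_smul _ _
  exact Finset.subset_biUnion_of_mem (fun k => (c k).support) (Finset.mem_univ k)

lemma signMean_norm_signSum_le_sqrt {B : Type*} [NormedAddCommGroup B] [NormedSpace ℂ B] {N : ℕ}
    (u : Fin N → B) : signMean (fun s => ‖signSum u s‖) ≤ √(radAvgSq u) := by
  have h := signMean_rpow_le (f := fun s => ‖signSum u s‖ ^ 2) (fun s => by positivity)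
    (θ := 1 / 2) (by norm_num) (by norm_num)
  simp only [← Real.sqrt_eq_rpow, Real.sqrt_sq (norm_nonneg _)] at h
  refine h.trans (le_of_eq ?_)
  congr 1
  rw [signMean, radAvgSq, smul_eq_mul, div_eq_inv_mul]
  congr 1
  refine Finset.sum_congr rfl fun s _ => ?_
  congr 2
  refine Finset.sum_congr rfl fun k _ => ?_
  rw [← Complex.coe_smul]
  congr 1
  cases s k <;> simp [boolSign]

/-- For `2 ≤ p, q < ∞`, the projective tensor product `L_p ⊗̂ L_q` has cotype
`max (p, q)`. -/
theorem projective_tensor_Lp_Lq_cotype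
    (p q : ℝ≥0∞) [Fact (1 ≤ p)] [Fact (1 ≤ q)]
    (hp2 : 2 ≤ p.toReal) (hq2 : 2 ≤ q.toReal) (hp : p ≠ ∞) (hq : q ≠ ∞)
    {S : Type*} [MeasurableSpace S] (μ : Measure S)
    {S' : Type*} [MeasurableSpace S'] (μ' : Measure S')
    {B : Type*} [NormedAddCommGroup B] [NormedSpace ℂ B] [CompleteSpace B]
    (j : Lp ℂ p μ →L[ℂ] Lp ℂ q μ' →L[ℂ] B) (hj : IsProjTensor j) :
    ∃ C : ℝ, 0 < C ∧ HasCotype B (max p.toReal q.toReal) C := by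
  set r := max p.toReal q.toReal with hr
  have hr0 : 0 < r := lt_of_lt_of_le (by linarith) (le_max_left p.toReal q.toReal)
  have hC : 0 < 2 * matrixCotypeConst p.toReal q.toReal := by
    have := khinchinConst_pos p.toReal
    have := khinchinConst_pos q.toReal
    unfold matrixCotypeConst
    positivity
  refine ⟨2 * matrixCotypeConst p.toReal q.toReal, hC, fun N u => ?_⟩
  have main : ∀ v : Fin N → B, lpNormFin r (fun k => ‖v k‖) ≤
      2 * matrixCotypeConst p.toReal q.toReal * signMean fun s => ‖signSum v s‖ := by
    have hd := dense_pi (Set.univ : Set (Fin N)) fun _ _ => hj.dense_span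
    refine fun v => hd.induction (P := fun v => lpNormFin r (fun k => ‖v k‖) ≤
      2 * matrixCotypeConst p.toReal q.toReal * signMean fun s => ‖signSum v s‖)
      (fun v hv => ?_) ?_ v
    · obtain ⟨T, c, hc⟩ := exists_common_representation fun k => hv k (Set.mem_univ k)
      obtain rfl : v = fun k => ∑ l, c k l • j l.1.1 l.1.2 := funext hc
      exact lpNormFin_norm_le_of_approx hj hp2 hq2 (le_max_left _ _) (le_max_right _ _) c
        (fun l => l.1.1) (fun l => l.1.2)
        (fun δ hδ => exists_isLpFactorization_approx hp _ hδ)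
        (fun δ hδ => exists_isLpFactorization_approx hq _ hδ)
    · refine isClosed_le ((continuous_lpNormFin hr0).comp (by fun_prop)) ?_
      unfold signMean signSum
      fun_prop
  have h := (main u).trans
    (mul_le_mul_of_nonneg_left (signMean_norm_signSum_le_sqrt u) hC.le)
  simpa only [lpNormFin, abs_norm] using h
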